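/- Let E_N be uniformly distributed on {-1,1}^N for each N ≥ 1, and let 𝒩 denote the normality measure. Then there exists a probability distribution function F, continuous on all of ℝ, such that for every t ∈ ℝ, lim_{N→∞} P( 𝒩(E_N)/√N ≤ t ) = F(t). -/

import Mathlib

open MeasureTheory Filter
open scoped ENNReal Topology

def patCount (e : ℕ → Bool) (M : ℕ) {k : ℕ} (X : Fin k → Bool) : ℕ :=
  ((Finset.range M).filter (fun n => ∀ i : Fin k, e (n + i) = X i)).card

/-- The normality measure `𝒩(E_N)`: the maximum of `|T(E_N,M,X) − M/2^k|` over
patterns `X` of length `1 ≤ k ≤ log₂ N` and `1 ≤ M ≤ N + 1 − k`. -/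
noncomputable def normality (N : ℕ) (e : ℕ → Bool) : ℝ :=
  sSup {x : ℝ | ∃ (k M : ℕ) (X : Fin k → Bool),
    1 ≤ k ∧ (k : ℝ) ≤ Real.logb 2 N ∧ 1 ≤ M ∧ M + k ≤ N + 1 ∧
    x = |(patCount e M X : ℝ) - (M : ℝ) / 2 ^ k|}

/-- Extend a finite binary sequence to `ℕ → Bool`. -/
def extendSeq {N : ℕ} (E : Fin N → Bool) : ℕ → Bool :=
  fun n => if h : n < N then E ⟨n, h⟩ else false

/-- The uniform probability measure on `{-1,1}^N`. -/
noncomputable def unifMeasure (N : ℕ) : Measure (Fin N → Bool) :=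
  (PMF.uniformOfFintype (Fin N → Bool)).toMeasure

open ProbabilityTheory

/-- The fair coin on `Bool`. -/
noncomputable def coin : Measure Bool := (PMF.uniformOfFintype Bool).toMeasure

instance : IsProbabilityMeasure coin := by unfold coin; infer_instance

/-- The law of an infinite sequence of independent fair coin tosses. -/
noncomputable def coinSeq : Measure (ℕ → Bool) := Measure.infinitePi fun _ => coin

instance : IsProbabilityMeasure coinSeq := by unfold coinSeq; infer_instance

lemma coin_singleton (b : Bool) : coin {b} = 2⁻¹ := by
  unfold coin
  rw [PMF.toMeasure_apply_singleton _ _ (measurableSet_singleton b)]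
  simp

lemma coin_real_singleton (b : Bool) : coin.real {b} = 2⁻¹ := by
  simp [measureReal_def, coin_singleton]

lemma integral_coin {E : Type*} [NormedAddCommGroup E] [NormedSpace ℝ E] [CompleteSpace E]
    (f : Bool → E) :
    ∫ b, f b ∂coin = (2⁻¹ : ℝ) • (f true + f false) := by
  rw [integral_fintype .of_finite]
  simp [coin_real_singleton]

lemma map_coinSeq_of_injective {α : Type*} {g : α → ℕ} (hg : Function.Injective g) :
    coinSeq.map (fun e a => e (g a)) = Measure.infinitePi fun _ : α => coin :=
  Measure.map_infinitePi_infinitePi_of_inj hg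

lemma map_coinSeq_blocks {p : ℕ} {g : ℕ → Fin p → ℕ}
    (hg : Function.Injective (Function.uncurry g)) :
    coinSeq.map (fun e b i => e (g b i)) =
      Measure.infinitePi fun _ : ℕ => Measure.infinitePi fun _ : Fin p => coin := by
  rw [← Measure.infinitePi_map_curry (fun (_ : ℕ) (_ : Fin p) => coin),
    ← map_coinSeq_of_injective hg, Measure.map_map (by fun_prop) (by fun_prop)]
  rfl

/-- Functions of disjoint blocks of coin tosses are independent. -/
lemma iIndepFun_blocks {p : ℕ} {g : ℕ → Fin p → ℕ} (hg : Function.Injective (Function.uncurry g))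
    {E : Type*} [MeasurableSpace E] (F : ℕ → (Fin p → Bool) → E) :
    iIndepFun (fun b e => F b (fun i => e (g b i))) coinSeq := by
  have hF : ∀ b, Measurable (F b) := fun b => .of_discrete
  have h := iIndepFun_infinitePi (P := fun _ : ℕ => Measure.infinitePi fun _ : Fin p => coin) hF
  rw [← map_coinSeq_blocks hg] at h
  have hm : ∀ b, Measurable (fun e : ℕ → Fin p → Bool => F b (e b)) :=
    fun b => (hF b).comp (measurable_pi_apply b)
  have : IsProbabilityMeasure (coinSeq.map fun e b i => e (g b i)) :=
    Measure.isProbabilityMeasure_map (Measurable.aemeasurable (by fun_prop))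
  exact (iIndepFun_iff_map_fun_eq_infinitePi_map (by
    intro b; exact (hF b).comp (by fun_prop))).2 (by
    have h2 := (iIndepFun_iff_map_fun_eq_infinitePi_map hm).1 h
    rw [Measure.map_map (by fun_prop) (by fun_prop)] at h2
    refine h2.trans ?_
    congr 1
    funext b
    rw [Measure.map_map (hm b) (by fun_prop)]
    rfl)

lemma integral_coinSeq_comp {α : Type*} [Finite α] {g : α → ℕ} (hg : Function.Injective g)
    {E : Type*} [NormedAddCommGroup E] [NormedSpace ℝ E] (F : (α → Bool) → E) :
    ∫ e, F (fun i => e (g i)) ∂coinSeq = ∫ x, F x ∂(Measure.infinitePi fun _ : α => coin) := by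
  have : AEStronglyMeasurable F (coinSeq.map (fun e a => e (g a))) := by
    exact StronglyMeasurable.of_discrete.aestronglyMeasurable
  rw [← map_coinSeq_of_injective hg,
    integral_map (measurable_pi_lambda _ fun a => measurable_pi_apply _).aemeasurable this]

lemma measurable_coinSeq_comp {α E : Type*} [Finite α] [MeasurableSpace E] (g : α → ℕ)
    (F : (α → Bool) → E) : Measurable (fun e : ℕ → Bool => F (fun i => e (g i))) :=
  (Measurable.of_discrete (f := F)).comp (by fun_prop)

/-- The indicator of an occurrence of `X` at position `n`, minus its mean. -/
noncomputable def dev {k : ℕ} (X : Fin k → Bool) (n : ℕ) (e : ℕ → Bool) : ℝ :=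
  (if ∀ i : Fin k, e (n + i) = X i then 1 else 0) - 1 / 2 ^ k

lemma patCount_sub {k : ℕ} (X : Fin k → Bool) (M : ℕ) (e : ℕ → Bool) :
    (patCount e M X : ℝ) - (M : ℝ) / 2 ^ k = ∑ n ∈ Finset.range M, dev X n e := by
  simp only [dev, Finset.sum_sub_distrib, patCount]
  simp [div_eq_mul_inv]

lemma measurable_dev {k : ℕ} (X : Fin k → Bool) (n : ℕ) : Measurable (dev X n) :=
  measurable_coinSeq_comp (fun i : Fin k => n + i)
    (fun w => (if ∀ i : Fin k, w i = X i then (1 : ℝ) else 0) - 1 / 2 ^ k)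

lemma abs_dev_le {k : ℕ} (X : Fin k → Bool) (n : ℕ) (e : ℕ → Bool) : |dev X n e| ≤ 1 := by
  have h1 : (0 : ℝ) < 1 / 2 ^ k := by positivity
  have h2 : (1 : ℝ) / 2 ^ k ≤ 1 := by
    rw [div_le_one (by positivity)]; exact one_le_pow₀ (by norm_num)
  unfold dev
  split_ifs <;> rw [abs_le] <;> constructor <;> linarith

lemma infinitePi_coin_singleton {k : ℕ} (X : Fin k → Bool) :
    (Measure.infinitePi fun _ : Fin k => coin).real {X} = 1 / 2 ^ k := by
  rw [measureReal_def, Measure.infinitePi_singleton_of_fintype]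
  simp [coin_singleton]

lemma integral_dev_comp {k : ℕ} (X : Fin k → Bool) (n : ℕ) (f : ℝ → ℝ) :
    ∫ e, f (dev X n e) ∂coinSeq =
      1 / 2 ^ k * f (1 - 1 / 2 ^ k) + (1 - 1 / 2 ^ k) * f (0 - 1 / 2 ^ k) := by
  have hinj : Function.Injective (fun i : Fin k => n + (i : ℕ)) := by
    intro i j h; simpa [Fin.ext_iff] using h
  have h := integral_coinSeq_comp hinj
    (fun w => f ((if ∀ i : Fin k, w i = X i then (1 : ℝ) else 0) - 1 / 2 ^ k))
  have h2 : ∀ w : Fin k → Bool,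
      f ((if ∀ i : Fin k, w i = X i then (1 : ℝ) else 0) - 1 / 2 ^ k) =
      ({X} : Set (Fin k → Bool)).indicator
        (fun _ => f (1 - 1 / 2 ^ k) - f (0 - 1 / 2 ^ k)) w + f (0 - 1 / 2 ^ k) := by
    intro w
    by_cases hw : w = X
    · subst hw; simp
    · have : ¬ ∀ i, w i = X i := fun h => hw (funext h)
      simp [hw, this]
  simp only [dev]
  rw [h]
  simp_rw [h2]
  rw [integral_add (.of_finite) (.of_finite),
    integral_indicator_const _ (measurableSet_singleton X),
    infinitePi_coin_singleton]
  simp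
  ring

lemma integral_dev {k : ℕ} (X : Fin k → Bool) (n : ℕ) : ∫ e, dev X n e ∂coinSeq = 0 := by
  have := integral_dev_comp X n id
  simp only [id] at this
  rw [this]; ring

lemma integral_dev_sq_le {k : ℕ} (X : Fin k → Bool) (n : ℕ) :
    ∫ e, dev X n e ^ 2 ∂coinSeq ≤ 1 / 2 ^ k := by
  rw [integral_dev_comp X n (fun x => x ^ 2)]
  have h1 : (0 : ℝ) < 1 / 2 ^ k := by positivity
  nlinarith

lemma integral_dev_four_le {k : ℕ} (X : Fin k → Bool) (n : ℕ) :
    ∫ e, dev X n e ^ 4 ∂coinSeq ≤ 1 / 2 ^ k := by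
  refine le_trans (integral_mono_of_nonneg (ae_of_all _ fun e => by positivity) ?_
    (ae_of_all _ fun e => ?_)) (integral_dev_sq_le X n)
  · refine Integrable.of_bound ((measurable_dev X n).pow_const 2).aestronglyMeasurable 1
      (ae_of_all _ fun e => ?_)
    rw [Real.norm_eq_abs, abs_pow]
    exact pow_le_one₀ (abs_nonneg _) (abs_dev_le X n e)
  · have h := pow_le_one₀ (n := 2) (abs_nonneg _) (abs_dev_le X n e)
    rw [sq_abs] at h
    have : 0 ≤ dev X n e ^ 2 := sq_nonneg _
    change dev X n e ^ 4 ≤ dev X n e ^ 2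
    nlinarith

/-- Partial sums of `x`, frozen as soon as their absolute value reaches `l`. -/
noncomputable def stoppedSum (l : ℝ) (x : ℕ → ℝ) : ℕ → ℝ
  | 0 => 0
  | n + 1 => if l ≤ |stoppedSum l x n| then stoppedSum l x n else stoppedSum l x n + x n

lemma measurable_stoppedSum (l : ℝ) (n : ℕ) : Measurable fun x : ℕ → ℝ => stoppedSum l x n := by
  induction n with
  | zero => exact measurable_const
  | succ n ih =>
    exact Measurable.ite (measurableSet_le measurable_const ih.abs) ih
      (ih.add (measurable_pi_apply n))

lemma stoppedSum_congr (l : ℝ) {x y : ℕ → ℝ} {n : ℕ} (h : ∀ i < n, x i = y i) :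
    stoppedSum l x n = stoppedSum l y n := by
  induction n with
  | zero => rfl
  | succ n ih =>
    have := ih fun i hi => h i (by omega)
    simp only [stoppedSum, this, h n (by omega)]

lemma stoppedSum_eq_or (l : ℝ) (x : ℕ → ℝ) (n : ℕ) :
    l ≤ |stoppedSum l x n| ∨
      (stoppedSum l x n = ∑ i ∈ Finset.range n, x i ∧
        ∀ m ≤ n, |∑ i ∈ Finset.range m, x i| < l) := by
  induction n with
  | zero =>
    by_cases h : l ≤ 0
    · left; simpa [stoppedSum] using h
    · right
      refine ⟨by simp [stoppedSum], fun m hm => ?_⟩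
      obtain rfl : m = 0 := by omega
      simpa using h
  | succ n ih =>
    rcases ih with h | ⟨h1, h2⟩
    · left; simp [stoppedSum, h]
    · have h3 : ¬ l ≤ |stoppedSum l x n| := by rw [h1]; exact not_le.2 (h2 n le_rfl)
      have h4 : stoppedSum l x (n + 1) = ∑ i ∈ Finset.range (n + 1), x i := by
        rw [stoppedSum, if_neg h3, h1, Finset.sum_range_succ]
      by_cases h5 : l ≤ |stoppedSum l x (n + 1)|
      · exact Or.inl h5
      · refine Or.inr ⟨h4, fun m hm => ?_⟩
        rcases Nat.lt_or_ge m (n + 1) with h6 | h6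
        · exact h2 m (by omega)
        · obtain rfl : m = n + 1 := by omega
          rw [← h4]; exact not_le.1 h5

lemma abs_stoppedSum_le (l : ℝ) {x : ℕ → ℝ} {C : ℝ} (hC : ∀ i, |x i| ≤ C) (n : ℕ) :
    |stoppedSum l x n| ≤ n * C := by
  have hC0 : 0 ≤ C := (abs_nonneg _).trans (hC 0)
  induction n with
  | zero => simp [stoppedSum]
  | succ n ih =>
    rw [stoppedSum]
    push_cast
    split_ifs
    · linarith
    · have := abs_add_le (stoppedSum l x n) (x n)
      linarith [hC n]

lemma indepFun_stoppedSum {Ω : Type*} [MeasurableSpace Ω] {μ : Measure Ω} {ξ : ℕ → Ω → ℝ}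
    (hξ : iIndepFun ξ μ) (hm : ∀ i, Measurable (ξ i))
    (l : ℝ) (n : ℕ) :
    IndepFun (fun ω => stoppedSum l (fun i => ξ i ω) n) (ξ n) μ := by
  have h := hξ.indepFun_finset (Finset.range n) {n} (by simp) hm
  have hx : Measurable fun x : (Finset.range n) → ℝ =>
      stoppedSum l (fun i => if h : i ∈ Finset.range n then x ⟨i, h⟩ else 0) n := by
    refine (measurable_stoppedSum l n).comp (measurable_pi_lambda _ fun i => ?_)
    by_cases hi : i ∈ Finset.range n
    · simp only [hi, dite_true]; exact measurable_pi_apply _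
    · simp only [hi, dite_false]; exact measurable_const
  have h2 := h.comp hx (measurable_pi_apply (⟨n, by simp⟩ : ({n} : Finset ℕ)))
  refine h2.congr (ae_of_all _ fun ω => ?_) (ae_of_all _ fun ω => rfl)
  refine stoppedSum_congr l fun i hi => ?_
  simp [hi]

section Moments

variable {Ω : Type*} [MeasurableSpace Ω] {μ : Measure Ω} [IsProbabilityMeasure μ] {ξ : ℕ → Ω → ℝ}
  {C a b : ℝ}

lemma integral_stoppedSum_le (hξ : iIndepFun ξ μ) (hm : ∀ i, Measurable (ξ i))
    (hC : ∀ i ω, |ξ i ω| ≤ C) (h1 : ∀ i, ∫ ω, ξ i ω ∂μ = 0) (h2 : ∀ i, ∫ ω, ξ i ω ^ 2 ∂μ ≤ a)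
    (h4 : ∀ i, ∫ ω, ξ i ω ^ 4 ∂μ ≤ b) (l : ℝ) (n : ℕ) :
    ∫ ω, stoppedSum l (fun i => ξ i ω) n ^ 2 ∂μ ≤ n * a ∧
      ∫ ω, stoppedSum l (fun i => ξ i ω) n ^ 4 ∂μ ≤ 4 * n ^ 2 * a ^ 2 + 3 * n * b := by
  have ha : 0 ≤ a := (integral_nonneg fun ω => sq_nonneg (ξ 0 ω)).trans (h2 0)
  have hb : 0 ≤ b := (integral_nonneg fun ω => by positivity).trans (h4 0)
  induction n with
  | zero => simp [stoppedSum]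
  | succ n ih =>
    obtain ⟨ih2, ih4⟩ := ih
    set T : Ω → ℝ := fun ω => stoppedSum l (fun i => ξ i ω) n with hT
    have hTm : Measurable T := (measurable_stoppedSum l n).comp (measurable_pi_lambda _ hm)
    have hTC : ∀ ω, |T ω| ≤ n * C := fun ω => abs_stoppedSum_le l (fun i => hC i ω) n
    have hind := indepFun_stoppedSum hξ hm l n
    set J : Ω → ℝ := fun ω => if l ≤ |T ω| then 0 else 1 with hJ
    have hJm : Measurable J :=
      Measurable.ite (measurableSet_le measurable_const hTm.abs) measurable_const measurable_const
    have hfm : ∀ k j : ℕ, Measurable fun t : ℝ => (if l ≤ |t| then (0 : ℝ) else 1) * t ^ k :=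
      fun k j => (Measurable.ite (measurableSet_le measurable_const measurable_id.abs)
        measurable_const measurable_const).mul (measurable_id.pow_const k)
    have hJ1 : ∀ ω, |J ω| ≤ 1 := fun ω => by simp only [hJ]; split_ifs <;> simp
    have h_int : ∀ k j : ℕ, Integrable (fun ω => J ω * T ω ^ k * ξ n ω ^ j) μ := fun k j => by
      refine Integrable.of_bound (C := 1 * (n * C) ^ k * C ^ j)
        (by fun_prop) (ae_of_all _ fun ω => ?_)
      rw [Real.norm_eq_abs, abs_mul, abs_mul, abs_pow, abs_pow]
      have := abs_nonneg (T ω)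
      have := abs_nonneg (ξ n ω)
      have := hTC ω
      have := hC n ω
      have := hJ1 ω
      have : 0 ≤ C := (abs_nonneg _).trans (hC n ω)
      gcongr
    have hprod : ∀ k j : ℕ, ∫ ω, J ω * T ω ^ k * ξ n ω ^ j ∂μ =
        (∫ ω, J ω * T ω ^ k ∂μ) * ∫ ω, ξ n ω ^ j ∂μ := fun k j => by
      have := hind.comp (hfm k j) (measurable_id.pow_const j)
      exact this.integral_fun_mul_eq_mul_integral (by
        exact ((hfm k j).comp hTm).aestronglyMeasurable) (by
        exact ((hm n).pow_const j).aestronglyMeasurable)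
    have hintT : ∀ k : ℕ, Integrable (fun ω => T ω ^ k) μ := fun k => by
      refine Integrable.of_bound (C := (n * C) ^ k) (by fun_prop) (ae_of_all _ fun ω => ?_)
      rw [Real.norm_eq_abs, abs_pow]
      have := hTC ω
      gcongr
    have hJT : ∀ k : ℕ, ∫ ω, J ω * T ω ^ (2 * k) ∂μ ≤ ∫ ω, T ω ^ (2 * k) ∂μ := fun k => by
      refine integral_mono (by simpa using h_int (2 * k) 0) (hintT _) fun ω => ?_
      have : 0 ≤ T ω ^ (2 * k) := by rw [pow_mul]; positivity
      simp only [hJ]; split_ifs <;> simp [this]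
    have hJ0 : 0 ≤ ∫ ω, J ω * T ω ^ 2 ∂μ := integral_nonneg fun ω => by
      simp only [hJ]; split_ifs
      · simp
      · simp only [one_mul]; positivity
    have hξ2 : 0 ≤ ∫ ω, ξ n ω ^ 2 ∂μ := integral_nonneg fun ω => sq_nonneg _
    have hξ4 : 0 ≤ ∫ ω, ξ n ω ^ 4 ∂μ := integral_nonneg fun ω => by positivity
    have e2 : ∀ ω, stoppedSum l (fun i => ξ i ω) (n + 1) ^ 2 =
        T ω ^ 2 + (2 * (J ω * T ω ^ 1 * ξ n ω ^ 1) + J ω * T ω ^ 0 * ξ n ω ^ 2) := fun ω => by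
      simp only [stoppedSum, hJ, hT]; split_ifs <;> ring
    have e4 : ∀ ω, stoppedSum l (fun i => ξ i ω) (n + 1) ^ 4 ≤
        T ω ^ 4 + (4 * (J ω * T ω ^ 3 * ξ n ω ^ 1) + (8 * (J ω * T ω ^ 2 * ξ n ω ^ 2) +
          3 * (J ω * T ω ^ 0 * ξ n ω ^ 4))) := fun ω => by
      simp only [stoppedSum, hJ]
      change (if l ≤ |T ω| then T ω else T ω + ξ n ω) ^ 4 ≤ _
      split_ifs
      · simp
      · nlinarith [sq_nonneg (T ω * ξ n ω - ξ n ω ^ 2)]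
    have hJ00 : ∫ ω, J ω * T ω ^ 0 ∂μ ≤ 1 := by
      have := hJT 0
      simpa using this
    have hJ2 : ∫ ω, J ω * T ω ^ 2 ∂μ ≤ n * a := (hJT 1).trans ih2
    constructor
    · simp_rw [e2]
      have hdom : Integrable
          (fun ω => 2 * (J ω * T ω ^ 1 * ξ n ω ^ 1) + J ω * T ω ^ 0 * ξ n ω ^ 2) μ :=
        ((h_int 1 1).const_mul 2).add (h_int 0 2)
      rw [integral_add (hintT 2) hdom,
        integral_add ((h_int 1 1).const_mul 2) (h_int 0 2), integral_const_mul, hprod, hprod]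
      simp only [pow_one, h1, mul_zero, zero_add]
      have := mul_le_mul hJ00 (h2 n) hξ2 zero_le_one
      push_cast
      linarith
    · have hdom := ((h_int 3 1).const_mul 4).add
        (((h_int 2 2).const_mul 8).add ((h_int 0 4).const_mul 3))
      refine (integral_mono_of_nonneg (ae_of_all _ fun ω => by positivity)
        ((hintT 4).add hdom) (ae_of_all _ e4)).trans ?_
      rw [integral_add' (hintT 4) hdom, integral_add' ((h_int 3 1).const_mul 4)
        (((h_int 2 2).const_mul 8).add ((h_int 0 4).const_mul 3)),
        integral_add' ((h_int 2 2).const_mul 8) ((h_int 0 4).const_mul 3),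
        integral_const_mul, integral_const_mul, integral_const_mul, hprod, hprod, hprod]
      simp only [pow_one, h1, mul_zero, zero_add]
      have h5 := mul_le_mul hJ00 (h4 n) hξ4 zero_le_one
      have h6 := mul_le_mul hJ2 (h2 n) hξ2 (by positivity)
      push_cast
      nlinarith [sq_nonneg a]

/-- A maximal inequality for partial sums of centred independent variables, in terms of their
second and fourth moments. -/
lemma measureReal_exists_abs_sum_ge_le (hξ : iIndepFun ξ μ) (hm : ∀ i, Measurable (ξ i))
    (hC : ∀ i ω, |ξ i ω| ≤ C) (h1 : ∀ i, ∫ ω, ξ i ω ∂μ = 0) (h2 : ∀ i, ∫ ω, ξ i ω ^ 2 ∂μ ≤ a)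
    (h4 : ∀ i, ∫ ω, ξ i ω ^ 4 ∂μ ≤ b) {l : ℝ} (hl : 0 < l) (n : ℕ) :
    μ.real {ω | ∃ m ≤ n, l ≤ |∑ i ∈ Finset.range m, ξ i ω|} ≤
      (4 * n ^ 2 * a ^ 2 + 3 * n * b) / l ^ 4 := by
  set T : Ω → ℝ := fun ω => stoppedSum l (fun i => ξ i ω) n with hT
  have hTm : Measurable T := (measurable_stoppedSum l n).comp (measurable_pi_lambda _ hm)
  have hTC : ∀ ω, |T ω| ≤ n * C := fun ω => abs_stoppedSum_le l (fun i => hC i ω) n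
  have hsub : {ω | ∃ m ≤ n, l ≤ |∑ i ∈ Finset.range m, ξ i ω|} ⊆ {ω | l ^ 4 ≤ T ω ^ 4} := by
    rintro ω ⟨m, hmn, hml⟩
    rcases stoppedSum_eq_or l (fun i => ξ i ω) n with h | ⟨-, h⟩
    · have := pow_le_pow_left₀ hl.le h 4
      rwa [Even.pow_abs (by decide)] at this
    · exact absurd hml (not_le.2 (h m hmn))
  have h_int : Integrable (fun ω => T ω ^ 4) μ := by
    refine Integrable.of_bound (C := (n * C) ^ 4) (by fun_prop) (ae_of_all _ fun ω => ?_)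
    rw [Real.norm_eq_abs, abs_pow]
    have := hTC ω
    gcongr
  refine (measureReal_mono hsub).trans ?_
  rw [le_div_iff₀ (by positivity), mul_comm]
  exact (mul_meas_ge_le_integral_of_nonneg (ae_of_all _ fun ω => by positivity) h_int _).trans
    (integral_stoppedSum_le hξ hm hC h1 h2 h4 l n).2

end Moments

section Local

variable {E : Type*} {p : ℕ} {G : (ℕ → Bool) → E}

lemma DependsOn.extendSeq_restrict (hG : DependsOn G (Set.Iio p)) (e : ℕ → Bool) :
    G (extendSeq fun i : Fin p => e i) = G e := by
  refine hG fun n hn => ?_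
  simp only [Set.mem_Iio] at hn
  simp [extendSeq, hn]

lemma DependsOn.measurable_of_Iio [MeasurableSpace E] (hG : DependsOn G (Set.Iio p)) :
    Measurable G := by
  have h := measurable_coinSeq_comp (fun i : Fin p => (i : ℕ)) (fun w => G (extendSeq w))
  simpa only [hG.extendSeq_restrict] using h

/-- Local functions of shifts of a coin sequence are independent if the shifts are spaced. -/
lemma DependsOn.iIndepFun_shift [MeasurableSpace E] (hG : DependsOn G (Set.Iio p)) (s : ℕ) :
    iIndepFun (fun (b : ℕ) (e : ℕ → Bool) => G fun n => e (s + b * p + n)) coinSeq := by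
  have hinj : Function.Injective
      (Function.uncurry fun (b : ℕ) (i : Fin p) => s + b * p + (i : ℕ)) := by
    rintro ⟨b, i⟩ ⟨c, j⟩ h
    simp only [Function.uncurry] at h
    have h' : b * p + i = c * p + j := by omega
    have hp : 0 < p := i.pos
    have h1 : b = c := by
      have key : ∀ (b : ℕ) (i : Fin p), (b * p + i) / p = b := fun b i => by
        rw [mul_comm, Nat.mul_add_div hp, Nat.div_eq_of_lt i.2, add_zero]
      rw [← key b i, ← key c j, h']
    subst h1
    have : (i : ℕ) = j := by omega
    simp [Fin.ext_iff, this]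
  have h := iIndepFun_blocks hinj (fun _ w => G (extendSeq w))
  convert! h using 3 with b e
  exact (hG.extendSeq_restrict _).symm

lemma map_shift_coinSeq (s : ℕ) : coinSeq.map (fun e n => e (s + n)) = coinSeq :=
  map_coinSeq_of_injective (add_right_injective s)

lemma integral_shift_coinSeq [NormedAddCommGroup E] [NormedSpace ℝ E] [MeasurableSpace E]
    [BorelSpace E] [SecondCountableTopology E] (hG : Measurable G) (s : ℕ) :
    ∫ e, G (fun n => e (s + n)) ∂coinSeq = ∫ e, G e ∂coinSeq := by
  conv_rhs => rw [← map_shift_coinSeq s]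
  rw [integral_map (measurable_pi_lambda _ fun a => measurable_pi_apply _).aemeasurable
    hG.aestronglyMeasurable]

end Local

section Dev

variable {k : ℕ} (X : Fin k → Bool)

lemma dependsOn_dev {i p : ℕ} (h : i + k ≤ p) : DependsOn (dev X i) (Set.Iio p) := by
  intro e e' hee
  have : ∀ j : Fin k, e (i + j) = e' (i + j) := fun j => hee _ (by simp; omega)
  simp only [dev, this]

lemma dependsOn_sum_dev {m p : ℕ} (h : m + k ≤ p + 1) :
    DependsOn (fun e => ∑ i ∈ Finset.range m, dev X i e) (Set.Iio p) := by
  intro e e' hee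
  refine Finset.sum_congr rfl fun i hi => dependsOn_dev X ?_ hee
  have := Finset.mem_range.1 hi
  omega

lemma dev_shift (s i : ℕ) (e : ℕ → Bool) : dev X i (fun n => e (s + n)) = dev X (s + i) e := by
  simp [dev, add_assoc]

lemma sum_range_eq_sum_residues (hk : 0 < k) (f : ℕ → ℝ) (M : ℕ) :
    ∑ n ∈ Finset.range M, f n = ∑ r ∈ Finset.range k,
      ∑ i ∈ Finset.range ((M + k - 1 - r) / k), f (r + i * k) := by
  rw [← Finset.sum_fiberwise_of_maps_to (s := Finset.range M) (t := Finset.range k)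
    (g := fun n => n % k) (fun n _ => Finset.mem_range.2 (Nat.mod_lt _ hk))]
  refine Finset.sum_congr rfl fun r hr => ?_
  have hr := Finset.mem_range.1 hr
  symm
  refine Finset.sum_bij (fun i _ => r + i * k) ?_ ?_ ?_ fun _ _ => rfl
  · intro i hi
    rw [Finset.mem_range, Nat.lt_iff_add_one_le, Nat.le_div_iff_mul_le hk] at hi
    have : (i + 1) * k = i * k + k := by ring
    simp only [Finset.mem_filter, Finset.mem_range, Nat.add_mul_mod_self_right,
      Nat.mod_eq_of_lt hr, and_true]
    omega
  · intro i _ j _ h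
    exact Nat.eq_of_mul_eq_mul_right hk (by simpa using h)
  · intro n hn
    simp only [Finset.mem_filter, Finset.mem_range] at hn
    have h1 := Nat.mod_add_div n k
    refine ⟨n / k, ?_, by rw [mul_comm]; omega⟩
    rw [Finset.mem_range, Nat.lt_iff_add_one_le, Nat.le_div_iff_mul_le hk]
    have : (n / k + 1) * k = k * (n / k) + k := by ring
    omega

/-- Maximal inequality for the deviation of the number of occurrences of a pattern. -/
lemma measureReal_exists_abs_sum_dev_ge_le (hk : 0 < k) (s m : ℕ) {l : ℝ} (hl : 0 < l) :
    coinSeq.real {e | ∃ M ≤ m, l ≤ |∑ n ∈ Finset.range M, dev X (s + n) e|} ≤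
      k ^ 5 * (4 * m ^ 2 * (1 / 2 ^ k) ^ 2 + 3 * m * (1 / 2 ^ k)) / l ^ 4 := by
  have hk' : (0 : ℝ) < k := by exact_mod_cast hk
  have hr : ∀ r, coinSeq.real
      {e | ∃ M ≤ m, l / k ≤ |∑ i ∈ Finset.range M, dev X (s + (r + i * k)) e|} ≤
      (4 * m ^ 2 * (1 / 2 ^ k) ^ 2 + 3 * m * (1 / 2 ^ k)) / (l / k) ^ 4 := fun r => by
    have hind := (dependsOn_dev X (i := 0) (p := k) (by simp)).iIndepFun_shift (s + r)
    simp_rw [dev_shift X] at hind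
    convert! measureReal_exists_abs_sum_ge_le hind (fun i => measurable_dev X _)
      (fun i e => abs_dev_le X _ e) (fun i => integral_dev X _) (fun i => integral_dev_sq_le X _)
      (fun i => integral_dev_four_le X _) (l := l / k) (by positivity) m using 11
    ring
  have hsub : {e | ∃ M ≤ m, l ≤ |∑ n ∈ Finset.range M, dev X (s + n) e|} ⊆
      ⋃ r ∈ Finset.range k,
        {e | ∃ M ≤ m, l / k ≤ |∑ i ∈ Finset.range M, dev X (s + (r + i * k)) e|} := by
    rintro e ⟨M, hM, hle⟩
    by_contra hcon
    simp only [Finset.mem_range, Set.mem_iUnion, Set.mem_ofPred_eq, not_exists, not_and, not_le]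
      at hcon
    rw [sum_range_eq_sum_residues hk] at hle
    have hlt : |∑ r ∈ Finset.range k, ∑ i ∈ Finset.range ((M + k - 1 - r) / k),
        dev X (s + (r + i * k)) e| < ∑ r ∈ Finset.range k, l / k := by
      refine (Finset.abs_sum_le_sum_abs _ _).trans_lt
        (Finset.sum_lt_sum_of_nonempty (by simpa using hk.ne') fun r hr => ?_)
      refine hcon r (Finset.mem_range.1 hr) _ (le_trans ?_ hM)
      rcases Nat.eq_zero_or_pos M with rfl | hM0
      · rw [Nat.div_eq_of_lt (by omega)]
      · refine Nat.div_le_of_le_mul ?_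
        have : k + M ≤ k * M + 1 := by nlinarith
        omega
    rw [Finset.sum_const, Finset.card_range, nsmul_eq_mul, mul_div_cancel₀ _ hk'.ne'] at hlt
    exact absurd hle (not_le.2 hlt)
  calc _ ≤ _ := measureReal_mono hsub (measure_ne_top _ _)
    _ ≤ _ := measureReal_biUnion_finset_le _ _
    _ ≤ ∑ r ∈ Finset.range k, _ := Finset.sum_le_sum fun r _ => hr r
    _ = _ := by
      rw [Finset.sum_const, Finset.card_range, nsmul_eq_mul]
      field_simp

/-- Maximal inequality for sums of short windows of deviations along an arithmetic progression. -/
lemma measureReal_exists_abs_sum_windows_ge_le {K p : ℕ} (hkK : k ≤ K) (hp : 2 * K ≤ p) (s m : ℕ)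
    {l : ℝ} (hl : 0 < l) :
    coinSeq.real {e | ∃ M ≤ m, l ≤ |∑ b ∈ Finset.range M, ∑ i ∈ Finset.range K,
      dev X (s + b * p + i) e|} ≤ 7 * m ^ 2 * K ^ 4 / l ^ 4 := by
  have hbd : ∀ e s, |∑ i ∈ Finset.range K, dev X (s + i) e| ≤ K := fun e s => by
    refine (Finset.abs_sum_le_sum_abs _ _).trans ?_
    refine (Finset.sum_le_sum fun i _ => abs_dev_le X _ e).trans ?_
    simp
  have hmeas : ∀ s, Measurable fun e => ∑ i ∈ Finset.range K, dev X (s + i) e := fun s =>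
    Finset.measurable_fun_sum _ fun i _ => measurable_dev X _
  have hind := (dependsOn_sum_dev X (m := K) (p := p) (by omega)).iIndepFun_shift s
  simp_rw [dev_shift X] at hind
  have hpow : ∀ b n, ∫ e, (∑ i ∈ Finset.range K, dev X (s + b * p + i) e) ^ (2 * n) ∂coinSeq ≤
      (K : ℝ) ^ (2 * n) := fun b n => by
    have := integral_mono_of_nonneg (μ := coinSeq)
      (f := fun e => (∑ i ∈ Finset.range K, dev X (s + b * p + i) e) ^ (2 * n))
      (g := fun _ => (K : ℝ) ^ (2 * n))
      (ae_of_all _ fun e => by simp only [pow_mul]; positivity) (integrable_const _)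
      (ae_of_all _ fun e => by
        have := pow_le_pow_left₀ (abs_nonneg _) (hbd e (s + b * p)) (2 * n)
        rwa [Even.pow_abs (by simp)] at this)
    simpa using this
  refine (measureReal_exists_abs_sum_ge_le hind (fun b => hmeas _) (fun b e => hbd e _) ?_
    (fun b => hpow b 1) (fun b => hpow b 2) hl m).trans ?_
  · intro b
    rw [integral_finsetSum _ fun i _ => Integrable.of_bound
      (measurable_dev X _).aestronglyMeasurable 1 (ae_of_all _ fun e => abs_dev_le X _ e)]
    simp [integral_dev]
  · have : (m : ℝ) ≤ m ^ 2 := by exact_mod_cast Nat.le_self_pow (by norm_num) m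
    gcongr
    have h4 : (0 : ℝ) ≤ K ^ 4 := by positivity
    have h5 : 4 * (m : ℝ) ^ 2 * ((K : ℝ) ^ (2 * 1)) ^ 2 + 3 * m * (K : ℝ) ^ (2 * 2) =
      4 * m ^ 2 * K ^ 4 + 3 * m * K ^ 4 := by ring
    rw [h5]
    nlinarith [mul_le_mul_of_nonneg_right this h4]

end Dev

section Levy

/-- Lévy's continuity theorem: pointwise convergence of characteristic functions to a function
continuous at the origin implies weak convergence to some probability measure. -/
lemma exists_tendsto_of_tendsto_charFun {E : Type*} [NormedAddCommGroup E] [InnerProductSpace ℝ E]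
    [FiniteDimensional ℝ E] [MeasurableSpace E] [BorelSpace E] {μ : ℕ → ProbabilityMeasure E}
    {f : E → ℂ} (hf : ContinuousAt f 0)
    (h : ∀ t, Tendsto (fun n => charFun (μ n : Measure E) t) atTop (𝓝 (f t))) :
    ∃ ν : ProbabilityMeasure E, Tendsto μ atTop (𝓝 ν) := by
  have htight := isTightMeasureSet_of_tendsto_charFun hf h
  have hcomp : IsCompact (closure (Set.range μ)) :=
    isCompact_closure_of_isTightMeasureSet (by simpa [Set.range] using htight)
  obtain ⟨ν, -, hν : Tendsto μ (hyperfilter ℕ : Filter ℕ) (𝓝 ν)⟩ :=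
    hcomp.ultrafilter_le_nhds ((hyperfilter ℕ).map μ)
      (.trans (by simp) (monotone_principal subset_closure))
  refine ⟨ν, ProbabilityMeasure.tendsto_of_tendsto_charFun fun t => ?_⟩
  have h1 : Tendsto (fun n => charFun (μ n : Measure E) t) (hyperfilter ℕ : Filter ℕ)
      (𝓝 (charFun (ν : Measure E) t)) := by
    rw [ProbabilityMeasure.tendsto_iff_forall_integral_rclike_tendsto ℂ] at hν
    simp_rw [charFun_eq_integral_innerProbChar]
    exact hν (BoundedContinuousFunction.innerProbChar t)
  have h2 := (h t).mono_left (Nat.hyperfilter_le_atTop)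
  rw [tendsto_nhds_unique h1 h2]
  exact h t

lemma tendsto_one_add_pow_exp_of_tendsto_div {g : ℕ → ℂ} {t : ℂ} {q : ℕ → ℕ} {c : ℝ}
    (hg : Tendsto (fun n => n * g n) atTop (𝓝 t))
    (hq : Tendsto (fun n => (q n : ℝ) / n) atTop (𝓝 c)) :
    Tendsto (fun n => (1 + g n) ^ q n) atTop (𝓝 (Complex.exp (c * t))) := by
  have h1 := Complex.tendsto_nat_mul_log_one_add_of_tendsto hg
  have h2 : Tendsto (fun n => (((q n : ℝ) / n : ℝ) : ℂ)) atTop (𝓝 c) :=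
    (Complex.continuous_ofReal.tendsto c).comp hq
  have h3 := (Complex.continuous_exp.tendsto _).comp (h2.mul h1)
  have hg0 : Tendsto g atTop (𝓝 0) := by
    have := (tendsto_inv_atTop_nhds_zero_nat (𝕜 := ℂ)).mul hg
    rw [zero_mul] at this
    refine this.congr' ?_
    filter_upwards [eventually_ne_atTop 0] with n hn
    field_simp
  refine h3.congr' ?_
  filter_upwards [eventually_ne_atTop 0, hg0.eventually_ne (show (0 : ℂ) ≠ -1 by simp)]
    with n hn hne
  have hn' : (n : ℂ) ≠ 0 := by exact_mod_cast hn
  have hne' : 1 + g n ≠ 0 := fun h => hne (by linear_combination h)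
  have : (((q n : ℝ) / n : ℝ) : ℂ) * (n * Complex.log (1 + g n)) = q n * Complex.log (1 + g n) := by
    push_cast
    field_simp
  simp only [Function.comp_apply]
  rw [this, Complex.exp_nat_mul, Complex.exp_log hne']

lemma tendsto_charFun_inv_sqrt_pow {Ω : Type*} {mΩ : MeasurableSpace Ω} {μ : Measure Ω}
    [IsProbabilityMeasure μ] {X : Ω → ℝ} (hX : MemLp X 2 μ) (h0 : ∫ ω, X ω ∂μ = 0) {q : ℕ → ℕ}
    {c : ℝ} (hq : Tendsto (fun n => (q n : ℝ) / n) atTop (𝓝 c)) :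
    Tendsto (fun n : ℕ => charFun (μ.map X) (√n)⁻¹ ^ q n) atTop
      (𝓝 (Complex.exp (c * (-(∫ ω, X ω ^ 2 ∂μ : ℝ) / 2)))) := by
  have hXm := hX.aestronglyMeasurable.aemeasurable
  have : IsProbabilityMeasure (μ.map X) := Measure.isProbabilityMeasure_map hXm
  have hid : MemLp id 2 (μ.map X) := (memLp_map_measure_iff (by fun_prop) hXm).2 hX
  have hs : Tendsto (fun n : ℕ => (√(n : ℝ))⁻¹) atTop (𝓝 0) :=
    tendsto_inv_atTop_zero.comp (Real.tendsto_sqrt_atTop.comp tendsto_natCast_atTop_atTop)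
  have key : Tendsto (fun n : ℕ => n * (charFun (μ.map X) (√n)⁻¹ - 1)) atTop
      (𝓝 (-(∫ ω, X ω ^ 2 ∂μ : ℝ) / 2)) := by
    have h := taylor_tendsto (n := 2) convex_univ (Set.mem_univ (0 : ℝ))
      (contDiff_charFun hid).contDiffOn
    rw [nhdsWithin_univ] at h
    have h1 := (h.comp hs).add_const (-((∫ ω, X ω ^ 2 ∂μ : ℝ) : ℂ) / 2)
    rw [zero_add] at h1
    refine h1.congr' ?_
    filter_upwards [eventually_gt_atTop 0] with n hn
    have hn' : (0 : ℝ) < n := by exact_mod_cast hn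
    have hsq : ((√(n : ℝ))⁻¹ ^ 2)⁻¹ = (n : ℝ) := by
      rw [inv_pow, inv_inv, Real.sq_sqrt hn'.le]
    have hsq' : ((√(n : ℝ) : ℝ) : ℂ) ^ 2 = n := by
      rw [← Complex.ofReal_pow, Real.sq_sqrt hn'.le, Complex.ofReal_natCast]
    have hn'' : (n : ℂ) ≠ 0 := by exact_mod_cast hn.ne'
    simp only [Function.comp_apply]
    rw [taylorWithinEval_charFun_two_zero hXm hid, sub_zero, hsq, h0, Complex.real_smul]
    simp only [Pi.pow_apply, Complex.ofReal_zero, zero_mul, add_zero, Complex.ofReal_inv, inv_pow,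
      hsq', Complex.ofReal_natCast]
    field_simp
    ring
  convert! tendsto_one_add_pow_exp_of_tendsto_div key hq using 3
  ring

/-- Functional central limit theorem for finitely many equally long blocks of an iid sequence of
bounded centered vectors, tested against a bounded continuous function. -/
lemma exists_tendsto_integral_block_sums {Ω 𝒳 : Type*} [Fintype 𝒳] {mΩ : MeasurableSpace Ω}
    {μ : Measure Ω} [IsProbabilityMeasure μ] {V : ℕ → Ω → 𝒳 → ℝ} (hind : iIndepFun V μ)
    (hid : ∀ b, IdentDistrib (V b) (V 0) μ μ) {C : ℝ} (hC : ∀ ω x, |V 0 ω x| ≤ C)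
    (h0 : ∀ x, ∫ ω, V 0 ω x ∂μ = 0) {q : ℕ → ℕ} {c : ℝ}
    (hq : Tendsto (fun n => (q n : ℝ) / n) atTop (𝓝 c)) {L : ℕ} {g : (Fin L × 𝒳 → ℝ) → ℝ}
    (hg : Continuous g) {B : ℝ} (hB : ∀ w, |g w| ≤ B) :
    ∃ ℓ : ℝ, Tendsto (fun n : ℕ => ∫ ω, g (fun a =>
      (√n)⁻¹ * ∑ b ∈ Finset.range (q n), V (a.1 * q n + b) ω a.2) ∂μ) atTop (𝓝 ℓ) := by
  have hVm : ∀ b, AEMeasurable (V b) μ := fun b => (hid b).aemeasurable_fst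
  have hVm' : ∀ b x, AEMeasurable (fun ω => V b ω x) μ := fun b x =>
    (measurable_pi_apply x).comp_aemeasurable (hVm b)
  let W : ℕ → Ω → EuclideanSpace ℝ (Fin L × 𝒳) := fun n ω => WithLp.toLp 2 fun a =>
    (√n)⁻¹ * ∑ b ∈ Finset.range (q n), V (a.1 * q n + b) ω a.2
  have hW : ∀ n, AEMeasurable (W n) μ := fun n => by
    refine (WithLp.measurable_toLp 2 _).comp_aemeasurable (aemeasurable_pi_lambda _ fun a => ?_)
    exact (Finset.aemeasurable_fun_sum _ fun b _ => hVm' _ _).const_mul _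
  let U : EuclideanSpace ℝ (Fin L × 𝒳) → Fin L → Ω → ℝ := fun θ l ω => ∑ x, V 0 ω x * θ (l, x)
  have hU : ∀ θ l, AEMeasurable (U θ l) μ := fun θ l =>
    Finset.aemeasurable_fun_sum _ fun x _ => (hVm' 0 x).mul_const _
  let ν : ℕ → ProbabilityMeasure (EuclideanSpace ℝ (Fin L × 𝒳)) := fun n =>
    ⟨μ.map (W n), Measure.isProbabilityMeasure_map (hW n)⟩
  have hchar : ∀ θ n, charFun (ν n : Measure (EuclideanSpace ℝ (Fin L × 𝒳))) θ =
      ∏ l, charFun (μ.map (U θ l)) (√n)⁻¹ ^ q n := by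
    intro θ n
    have hinj : Function.Injective fun a : Fin L × Fin (q n) => (a.1 * q n + a.2 : ℕ) := by
      rintro ⟨l, b⟩ ⟨l', b'⟩ h
      have hq0 : 0 < q n := b.pos
      have hdiv : ∀ (l : ℕ) (b : Fin (q n)), (l * q n + b) / q n = l := fun l b => by
        rw [mul_comm, Nat.mul_add_div hq0, Nat.div_eq_of_lt b.2, add_zero]
      simp only at h
      have h1 : (l : ℕ) = l' := by rw [← hdiv l b, h, hdiv l' b']
      have h2 : (b : ℕ) = b' := by rw [h1] at h; omega
      simp [Fin.ext_iff, h1, h2]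
    have hprod := ((hind.precomp hinj).comp
      (fun (a : Fin L × Fin (q n)) (v : 𝒳 → ℝ) =>
        Complex.exp ((√n)⁻¹ * (∑ x, v x * θ (a.1, x) : ℝ) * Complex.I))
      (fun a => by fun_prop)).integral_fun_prod_eq_prod_integral
      (fun a => (Measurable.comp_aemeasurable (by fun_prop) (hVm _)).aestronglyMeasurable)
    have hone : ∀ a : Fin L × Fin (q n), ∫ ω, Complex.exp ((√n)⁻¹ *
        (∑ x, V (a.1 * q n + a.2) ω x * θ (a.1, x) : ℝ) * Complex.I) ∂μ =
        charFun (μ.map (U θ a.1)) (√n)⁻¹ := by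
      intro a
      rw [charFun_apply_real, integral_map (hU θ a.1) (by fun_prop)]
      have := ((hid (a.1 * q n + a.2)).comp (u := fun v : 𝒳 → ℝ =>
        Complex.exp ((√n)⁻¹ * (∑ x, v x * θ (a.1, x) : ℝ) * Complex.I)) (by fun_prop)).integral_eq
      simpa [U, Function.comp_def] using this
    simp only [Function.comp_apply] at hprod
    simp_rw [hone, Fintype.prod_prod_type, Finset.prod_const, Finset.card_univ,
      Fintype.card_fin] at hprod
    rw [← hprod]
    change charFun (μ.map (W n)) θ = _
    rw [charFun_apply, integral_map (hW n) (by fun_prop)]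
    refine integral_congr_ae (ae_of_all _ fun ω => ?_)
    simp only
    simp_rw [← Complex.exp_sum, ← Finset.sum_mul]
    congr 2
    rw [PiLp.inner_apply]
    simp only [W, RCLike.inner_apply, conj_trivial, Fintype.sum_prod_type]
    push_cast
    refine Finset.sum_congr rfl fun l _ => ?_
    simp_rw [Finset.mul_sum, Finset.sum_range]
    rw [Finset.sum_comm]
    refine Finset.sum_congr rfl fun b _ => Finset.sum_congr rfl fun x _ => ?_
    ring
  have h_int : ∀ x y, Integrable (fun ω => V 0 ω x * V 0 ω y) μ := fun x y =>
    Integrable.of_bound ((hVm' 0 x).mul (hVm' 0 y)).aestronglyMeasurable (C * C)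
      (ae_of_all _ fun ω => by
        rw [norm_mul]
        exact mul_le_mul (hC ω x) (hC ω y) (norm_nonneg _) ((abs_nonneg _).trans (hC ω x)))
  have hsq : ∀ θ l, ∫ ω, U θ l ω ^ 2 ∂μ =
      ∑ x, ∑ y, (∫ ω, V 0 ω x * V 0 ω y ∂μ) * (θ (l, x) * θ (l, y)) := fun θ l => by
    simp only [U, sq, Finset.sum_mul_sum]
    rw [integral_finsetSum _ fun x _ => integrable_finsetSum _ fun y _ =>
      ((h_int x y).mul_const (θ (l, x) * θ (l, y))).congr (ae_of_all _ fun ω => by ring)]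
    refine Finset.sum_congr rfl fun x _ => ?_
    rw [integral_finsetSum _ fun y _ =>
      ((h_int x y).mul_const (θ (l, x) * θ (l, y))).congr (ae_of_all _ fun ω => by ring)]
    refine Finset.sum_congr rfl fun y _ => ?_
    rw [← integral_mul_const]
    exact integral_congr_ae (ae_of_all _ fun ω => by ring)
  obtain ⟨ν', hν'⟩ := exists_tendsto_of_tendsto_charFun (μ := ν)
    (f := fun θ => ∏ l, Complex.exp (c * (-(∫ ω, U θ l ω ^ 2 ∂μ : ℝ) / 2))) (by
      simp_rw [hsq]
      exact Continuous.continuousAt (by fun_prop)) (fun θ => by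
      simp_rw [hchar]
      refine tendsto_finsetProd _ fun l _ => tendsto_charFun_inv_sqrt_pow ?_ ?_ hq
      · refine MemLp.of_bound (hU θ l).aestronglyMeasurable (∑ x, C * |θ (l, x)|)
          (ae_of_all _ fun ω => (norm_sum_le _ _).trans (Finset.sum_le_sum fun x _ => ?_))
        rw [norm_mul]
        exact mul_le_mul_of_nonneg_right (hC ω x) (abs_nonneg _)
      · simp only [U]
        rw [integral_finsetSum _ fun x _ => (Integrable.of_bound (hVm' 0 x).aestronglyMeasurable C
          (ae_of_all _ fun ω => hC ω x)).mul_const _]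
        simp [integral_mul_const, h0])
  refine ⟨∫ w, g (WithLp.ofLp w) ∂(ν' : Measure (EuclideanSpace ℝ (Fin L × 𝒳))), ?_⟩
  have hcont : Continuous fun w : EuclideanSpace ℝ (Fin L × 𝒳) => g (WithLp.ofLp w) :=
    hg.comp (PiLp.continuous_ofLp 2 _)
  have := (ProbabilityMeasure.tendsto_iff_forall_integral_tendsto.1 hν')
    (BoundedContinuousFunction.ofNormedAddCommGroup _ hcont B fun w => hB _)
  refine this.congr fun n => ?_
  exact integral_map (hW n) hcont.aestronglyMeasurable

end Levy

section Concentration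

/-- A bound on concentration probabilities by characteristic functions. -/
lemma measureReal_abs_sub_le_le_integral_charFun {Ω : Type*} {mΩ : MeasurableSpace Ω}
    {μ : Measure Ω} [IsProbabilityMeasure μ] {Y : Ω → ℝ} (hY : Measurable Y) (y : ℝ) {l : ℝ}
    (hl : 0 < l) :
    μ.real {ω | |Y ω - y| ≤ l} ≤
      Real.exp (1 / 2) * ∫ ξ, ‖charFun (μ.map Y) (ξ / l)‖ ∂gaussianReal 0 1 := by
  have hgauss : ∀ u : ℝ, ∫ ξ, Complex.exp (u * ξ * Complex.I) ∂gaussianReal 0 1 =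
      Real.exp (-u ^ 2 / 2) := fun u => by
    rw [← charFun_apply_real, charFun_gaussianReal]
    push_cast
    congr 1
    simp
    ring
  have hswap : ∫ ω, (Real.exp (-((Y ω - y) / l) ^ 2 / 2) : ℂ) ∂μ =
      ∫ ξ, Complex.exp (-(y / l * ξ : ℝ) * Complex.I) * charFun (μ.map Y) (ξ / l)
        ∂gaussianReal 0 1 := by
    simp_rw [← hgauss]
    rw [integral_integral_swap]
    · refine integral_congr_ae (ae_of_all _ fun ξ => ?_)
      simp only
      rw [charFun_apply_real, integral_map hY.aemeasurable (by fun_prop), ← integral_const_mul]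
      refine integral_congr_ae (ae_of_all _ fun ω => ?_)
      simp only
      rw [← Complex.exp_add]
      congr 1
      push_cast
      ring
    · refine Integrable.of_bound (by fun_prop) 1 (ae_of_all _ fun x => ?_)
      simp only [Function.uncurry]
      rw [← Complex.ofReal_mul, Complex.norm_exp_ofReal_mul_I]
  have hle : ∫ ω, Real.exp (-((Y ω - y) / l) ^ 2 / 2) ∂μ ≤
      ∫ ξ, ‖charFun (μ.map Y) (ξ / l)‖ ∂gaussianReal 0 1 := by
    rw [integral_complex_ofReal] at hswap
    refine (le_abs_self _).trans ?_
    rw [← Real.norm_eq_abs, ← Complex.norm_real, hswap]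
    refine (norm_integral_le_integral_norm _).trans (le_of_eq ?_)
    refine integral_congr_ae (ae_of_all _ fun ξ => ?_)
    simp only
    rw [norm_mul, ← Complex.ofReal_neg, Complex.norm_exp_ofReal_mul_I, one_mul]
  have hind : μ.real {ω | |Y ω - y| ≤ l} =
      ∫ ω, {ω | |Y ω - y| ≤ l}.indicator (fun _ => (1 : ℝ)) ω ∂μ := by
    rw [integral_indicator_const _ (measurableSet_le (by fun_prop) (by fun_prop))]
    simp
  calc _ = _ := hind
    _ ≤ ∫ ω, Real.exp (1 / 2) * Real.exp (-((Y ω - y) / l) ^ 2 / 2) ∂μ := by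
      refine integral_mono_of_nonneg (ae_of_all _ fun ω => Set.indicator_nonneg (by simp) _) ?_
        (ae_of_all _ fun ω => ?_)
      · refine (Integrable.of_bound (by fun_prop) 1 (ae_of_all _ fun ω => ?_)).const_mul _
        rw [Real.norm_eq_abs, Real.abs_exp, Real.exp_le_one_iff]
        have := sq_nonneg ((Y ω - y) / l)
        linarith
      · refine Set.indicator_apply_le' (fun hω => ?_) (fun _ => by positivity)
        simp only
        rw [← Real.exp_add, Real.one_le_exp_iff]
        have h1 : |(Y ω - y) / l| ≤ 1 := by
          rw [abs_div, abs_of_pos hl, div_le_one hl]; exact hω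
        have := (sq_le_one_iff_abs_le_one _).2 h1
        linarith
    _ ≤ _ := by
      rw [integral_const_mul]
      exact mul_le_mul_of_nonneg_left hle (by positivity)

lemma tendsto_integral_exp_neg_mul_sq_gaussianReal :
    Tendsto (fun a : ℝ => ∫ ξ, Real.exp (-a * ξ ^ 2) ∂gaussianReal 0 1) atTop (𝓝 0) := by
  have : NullSingletonClass (gaussianReal 0 1) := nullSingletonClass_gaussianReal (by simp)
  have hzero : ∫ _, (0 : ℝ) ∂gaussianReal 0 1 = 0 := by simp
  rw [show 𝓝 (0 : ℝ) = 𝓝 (∫ _, (0 : ℝ) ∂gaussianReal 0 1) by rw [hzero]]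
  refine tendsto_integral_filter_of_dominated_convergence (fun _ => 1)
    (Eventually.of_forall fun a =>
      (by fun_prop : Measurable fun ξ : ℝ => Real.exp (-a * ξ ^ 2)).aestronglyMeasurable)
    ?_ (integrable_const (μ := gaussianReal 0 1) (1 : ℝ)) ?_
  · filter_upwards [eventually_ge_atTop 0] with a ha
    refine ae_of_all _ fun ξ => ?_
    rw [Real.norm_eq_abs, Real.abs_exp, Real.exp_le_one_iff]
    have := sq_nonneg ξ
    nlinarith
  · filter_upwards [Measure.ae_ne (gaussianReal 0 1) 0] with ξ hξ
    have : 0 < ξ ^ 2 := by positivity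
    simp_rw [neg_mul]
    exact Real.tendsto_exp_neg_atTop_nhds_zero.comp (tendsto_id.atTop_mul_const this)

/-- Gaussian decay of the characteristic functions on `[-π, π]` yields anticoncentration. -/
lemma exists_measureReal_abs_sub_le_le {Ω : Type*} {mΩ : MeasurableSpace Ω}
    (μ : Measure Ω) [IsProbabilityMeasure μ] {κ δ : ℝ} (hκ : 0 < κ) (hδ : 0 < δ) :
    ∃ ε > 0, ∃ N₀ : ℕ, ∀ N ≥ N₀, ∀ Y : Ω → ℝ, Measurable Y →
      (∀ v, |v| ≤ Real.pi → ‖charFun (μ.map Y) v‖ ≤ Real.exp (-(κ * N) * v ^ 2)) →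
      ∀ y, μ.real {ω | |Y ω - y| ≤ ε * √N} ≤ δ := by
  have hE : 0 < Real.exp (1 / 2) := Real.exp_pos _
  obtain ⟨a, ha0, ha⟩ : ∃ a > 0, Real.exp (1 / 2) *
      ∫ ξ, Real.exp (-a * ξ ^ 2) ∂gaussianReal 0 1 ≤ δ / 2 := by
    have h := tendsto_integral_exp_neg_mul_sq_gaussianReal.const_mul (Real.exp (1 / 2))
    rw [mul_zero] at h
    obtain ⟨a, ha, ha'⟩ := ((eventually_gt_atTop 0).and
      (h.eventually_le_const (by positivity : 0 < δ / 2))).exists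
    exact ⟨a, ha, ha'⟩
  have hπ := Real.pi_pos
  set ε := √(κ / a) with hε
  have hε0 : 0 < ε := by positivity
  have hε2 : ε ^ 2 = κ / a := Real.sq_sqrt (by positivity)
  obtain ⟨N₀, hN₀⟩ := exists_nat_gt (Real.exp (1 / 2) / (Real.pi ^ 2 * ε ^ 2) / (δ / 2))
  refine ⟨ε, hε0, N₀ + 1, fun N hN Y hY hchar y => ?_⟩
  have hNpos : (0 : ℝ) < N := by exact_mod_cast (by omega : 0 < N)
  have hNN : (N₀ : ℝ) ≤ N := by exact_mod_cast (by omega : N₀ ≤ N)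
  have hl : 0 < ε * √N := by positivity
  have hl2 : (ε * √N) ^ 2 = ε ^ 2 * N := by rw [mul_pow, Real.sq_sqrt hNpos.le]
  have hmem : MemLp (fun ξ : ℝ => ξ) 2 (gaussianReal 0 1) := memLp_id_gaussianReal 2
  have hint2 : Integrable (fun ξ : ℝ => ξ ^ 2) (gaussianReal 0 1) := hmem.integrable_sq
  have hvar : ∫ ξ, ξ ^ 2 ∂gaussianReal 0 1 = 1 := by
    have h := variance_of_integral_eq_zero (X := fun ξ : ℝ => ξ) (μ := gaussianReal 0 1)
      (by fun_prop) integral_id_gaussianReal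
    rw [← h, variance_fun_id_gaussianReal]
    simp
  have hint1 : Integrable (fun ξ : ℝ => Real.exp (-a * ξ ^ 2)) (gaussianReal 0 1) := by
    refine Integrable.of_bound (by fun_prop) 1 (ae_of_all _ fun ξ => ?_)
    rw [Real.norm_eq_abs, Real.abs_exp, Real.exp_le_one_iff]
    have := sq_nonneg ξ
    nlinarith
  refine (measureReal_abs_sub_le_le_integral_charFun hY y hl).trans ?_
  have hbound : ∫ ξ, ‖charFun (μ.map Y) (ξ / (ε * √N))‖ ∂gaussianReal 0 1 ≤
      ∫ ξ, (Real.exp (-a * ξ ^ 2) + ξ ^ 2 * (Real.pi ^ 2 * (ε ^ 2 * N))⁻¹) ∂gaussianReal 0 1 := by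
    have : IsProbabilityMeasure (μ.map Y) := Measure.isProbabilityMeasure_map hY.aemeasurable
    refine integral_mono_of_nonneg (ae_of_all _ fun ξ => norm_nonneg _)
      (hint1.add (hint2.mul_const _)) (ae_of_all _ fun ξ => ?_)
    simp only
    by_cases hξ : |ξ / (ε * √N)| ≤ Real.pi
    · refine (hchar _ hξ).trans (le_add_of_le_of_nonneg (le_of_eq ?_) (by positivity))
      rw [div_pow, hl2, hε2]
      field_simp
    · refine (norm_charFun_le_one _).trans ?_
      have h1 : Real.pi ^ 2 ≤ (ξ / (ε * √N)) ^ 2 := by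
        rw [← sq_abs (ξ / _)]
        exact pow_le_pow_left₀ hπ.le (not_le.1 hξ).le 2
      rw [div_pow, hl2, le_div_iff₀ (by positivity)] at h1
      have h2 : 1 ≤ ξ ^ 2 * (Real.pi ^ 2 * (ε ^ 2 * N))⁻¹ := by
        rw [← div_eq_mul_inv, one_le_div (by positivity)]
        exact h1
      have := Real.exp_pos (-a * ξ ^ 2)
      linarith
  rw [integral_add hint1 (hint2.mul_const _), integral_mul_const, hvar, one_mul] at hbound
  have h3 : Real.exp (1 / 2) * (Real.pi ^ 2 * (ε ^ 2 * N))⁻¹ ≤ δ / 2 := by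
    have h4 := hN₀.le.trans hNN
    rw [div_le_iff₀ (by positivity), div_le_iff₀ (by positivity)] at h4
    rw [← div_eq_mul_inv, div_le_iff₀ (by positivity)]
    linarith
  have := mul_le_mul_of_nonneg_left hbound hE.le
  linarith [mul_add (Real.exp (1 / 2)) (∫ ξ, Real.exp (-a * ξ ^ 2) ∂gaussianReal 0 1)
    (Real.pi ^ 2 * (ε ^ 2 * N))⁻¹]

end Concentration

section Switch

/-- Resampling the coins with index in `C`. -/
def resample (C : Finset ℕ) (e s : ℕ → Bool) : ℕ → Bool := fun i => if i ∈ C then s i else e i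

lemma measurable_resample (C : Finset ℕ) :
    Measurable fun x : (ℕ → Bool) × (ℕ → Bool) => resample C x.1 x.2 := by
  refine measurable_pi_lambda _ fun i => ?_
  unfold resample
  split_ifs <;> fun_prop

lemma map_resample (C : Finset ℕ) :
    (coinSeq.prod coinSeq).map (fun x => resample C x.1 x.2) = coinSeq := by
  refine Measure.eq_infinitePi _ fun S t ht => ?_
  rw [Measure.map_apply (measurable_resample C)
    (MeasurableSet.pi S.countable_toSet fun i _ => ht i)]
  have : (fun x : (ℕ → Bool) × (ℕ → Bool) => resample C x.1 x.2) ⁻¹' (Set.pi S t) =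
      (Set.pi (S.filter (· ∉ C) : Finset ℕ) t) ×ˢ (Set.pi (S.filter (· ∈ C) : Finset ℕ) t) := by
    ext x
    simp only [Set.mem_preimage, Set.mem_pi, Set.mem_prod, resample, Finset.coe_filter,
      Set.mem_ofPred_eq, Finset.mem_coe]
    constructor
    · exact fun h => ⟨fun i hi => by simpa [hi.2] using h i hi.1,
        fun i hi => by simpa [hi.2] using h i hi.1⟩
    · intro h i hi
      by_cases hC : i ∈ C
      · simpa [hC] using h.2 i ⟨hi, hC⟩
      · simpa [hC] using h.1 i ⟨hi, hC⟩
  rw [this, Measure.prod_prod]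
  unfold coinSeq
  rw [Measure.infinitePi_pi _ fun i _ => ht i, Measure.infinitePi_pi _ fun i _ => ht i, mul_comm,
    Finset.prod_filter_mul_prod_filter_not]

lemma integral_prod_coinSeq {J : ℕ} {g : Fin J → ℕ} (hg : Function.Injective g)
    (f : Fin J → Bool → ℂ) :
    ∫ s, ∏ j, f j (s (g j)) ∂coinSeq = ∏ j, (f j true + f j false) / 2 := by
  rw [integral_coinSeq_comp hg (fun x => ∏ j, f j (x j)), Measure.infinitePi_eq_pi,
    integral_fintype_prod_eq_prod]
  refine Finset.prod_congr rfl fun j _ => ?_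
  rw [integral_coin, Complex.real_smul]
  push_cast
  ring

/-- A random variable depending additively on the coins at spaced switch positions has small
characteristic function. -/
lemma norm_charFun_le_pow_of_switch {p J a : ℕ} (ha : a < p) {Δ : (ℕ → Bool) → ℝ}
    (hΔ : DependsOn Δ (Set.Iio p)) {Y B : (ℕ → Bool) → ℝ} (hY : Measurable Y)
    (h : ∀ e s, Y (resample ((Finset.range J).image fun j => j * p + a) e s) =
      B e + ∑ j : Fin J, if s (j * p + a) then Δ fun n => e (j * p + n) else 0) {v r : ℝ}
    (hr : ∫ e, ‖(Complex.exp (v * Δ e * Complex.I) + 1) / 2‖ ∂coinSeq ≤ r) :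
    ‖charFun (coinSeq.map Y) v‖ ≤ r ^ J := by
  set C := (Finset.range J).image fun j => j * p + a
  have hp : 0 < p := by omega
  have hinj : Function.Injective fun j : Fin J => (j * p + a : ℕ) := by
    intro i j hij
    have : (i : ℕ) * p = j * p := by simpa using hij
    exact Fin.ext (Nat.eq_of_mul_eq_mul_right hp this)
  have hΔm := hΔ.measurable_of_Iio
  have h1 : charFun (coinSeq.map Y) v = ∫ e, ∫ s, Complex.exp (v * Y (resample C e s) * Complex.I)
      ∂coinSeq ∂coinSeq := by
    rw [charFun_apply_real, integral_map hY.aemeasurable (by fun_prop)]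
    conv_lhs => rw [← map_resample C]
    rw [integral_map (measurable_resample C).aemeasurable (by fun_prop), integral_prod]
    refine Integrable.of_bound (Measurable.aestronglyMeasurable ?_) 1 (ae_of_all _ fun x => ?_)
    · exact Measurable.comp (g := fun y : ℝ => Complex.exp (v * y * Complex.I)) (by fun_prop)
        (hY.comp (measurable_resample C))
    · rw [← Complex.ofReal_mul, Complex.norm_exp_ofReal_mul_I]
  have h2 : ∀ e, ∫ s, Complex.exp (v * Y (resample C e s) * Complex.I) ∂coinSeq =
      Complex.exp (v * B e * Complex.I) *
        ∏ j : Fin J, (Complex.exp (v * Δ (fun n => e (j * p + n)) * Complex.I) + 1) / 2 := by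
    intro e
    have h3 := integral_prod_coinSeq hinj fun j b =>
      Complex.exp (v * (if b then Δ fun n => e (j * p + n) else 0 : ℝ) * Complex.I)
    simp only [if_true, Complex.ofReal_zero, mul_zero, zero_mul, Complex.exp_zero,
      Bool.false_eq_true, if_false] at h3
    rw [← h3, ← integral_const_mul]
    refine integral_congr_ae (ae_of_all _ fun s => ?_)
    simp only [h]
    rw [← Complex.exp_sum, ← Complex.exp_add]
    congr 1
    rw [← Finset.sum_mul, ← Finset.mul_sum]
    push_cast
    ring
  have hind := ((hΔ.iIndepFun_shift 0).comp
    (fun _ x => ‖(Complex.exp (v * x * Complex.I) + 1) / 2‖) fun _ => by fun_prop).precomp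
    (g := fun j : Fin J => (j : ℕ)) Fin.val_injective
  have hprod := hind.integral_fun_prod_eq_prod_integral fun j => by
    refine (Measurable.comp (by fun_prop) (hΔm.comp (by fun_prop))).aestronglyMeasurable
  simp only [Function.comp_apply, zero_add] at hprod
  have hone : ∀ j : Fin J,
      ∫ e, ‖(Complex.exp (v * Δ (fun n => e (j * p + n)) * Complex.I) + 1) / 2‖ ∂coinSeq =
      ∫ e, ‖(Complex.exp (v * Δ e * Complex.I) + 1) / 2‖ ∂coinSeq := fun j =>
    integral_shift_coinSeq (G := fun e => ‖(Complex.exp (v * Δ e * Complex.I) + 1) / 2‖)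
      (by fun_prop) (j * p)
  simp_rw [hone, Finset.prod_const, Finset.card_univ, Fintype.card_fin] at hprod
  rw [h1]
  refine (norm_integral_le_integral_norm _).trans ?_
  simp_rw [h2, norm_mul, ← Complex.ofReal_mul, Complex.norm_exp_ofReal_mul_I, one_mul, norm_prod,
    Complex.ofReal_mul]
  rw [hprod]
  exact pow_le_pow_left₀ (integral_nonneg fun _ => norm_nonneg _) hr J

lemma sum_range_mul_eq {M : Type*} [AddCommMonoid M] (f : ℕ → M) (J p : ℕ) :
    ∑ n ∈ Finset.range (J * p), f n =
      ∑ j ∈ Finset.range J, ∑ i ∈ Finset.range p, f (j * p + i) := by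
  induction J with
  | zero => simp
  | succ J ih => rw [add_mul, one_mul, Finset.sum_range_add, ih, Finset.sum_range_succ]

variable {k : ℕ} (X : Fin k → Bool)

/-- The change of the number of occurrences of `X` when the coin `k - 1` is switched on. -/
noncomputable def switchGain (e : ℕ → Bool) : ℝ :=
  ∑ i ∈ Finset.range k, (dev X i (Function.update e (k - 1) true) -
    dev X i (Function.update e (k - 1) false))

lemma dependsOn_switchGain : DependsOn (switchGain X) (Set.Iio (2 * k)) := by
  intro e e' hee
  have h : ∀ b, ∀ m ∈ Set.Iio (2 * k),
      Function.update e (k - 1) b m = Function.update e' (k - 1) b m := fun b m hm => by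
    by_cases hmk : m = k - 1
    · simp [hmk]
    · simp [hmk, hee m hm]
  refine Finset.sum_congr rfl fun i hi => ?_
  have := Finset.mem_range.1 hi
  have hd := dependsOn_dev X (i := i) (p := 2 * k) (by omega)
  rw [hd (h true), hd (h false)]

lemma sum_dev_resample (hk : 0 < k) {J M : ℕ} (hM : J * (2 * k) ≤ M) (e s : ℕ → Bool) :
    ∑ n ∈ Finset.range M,
      dev X n (resample ((Finset.range J).image fun j => j * (2 * k) + (k - 1)) e s) =
    ∑ n ∈ Finset.range M, dev X n
      (resample ((Finset.range J).image fun j => j * (2 * k) + (k - 1)) e fun _ => false) +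
    ∑ j : Fin J, if s (j * (2 * k) + (k - 1)) then
      switchGain X fun n => e (j * (2 * k) + n) else 0 := by
  set C := (Finset.range J).image fun j => j * (2 * k) + (k - 1) with hC
  have hmem : ∀ j < J, ∀ m < 2 * k, j * (2 * k) + m ∈ C ↔ m = k - 1 := by
    intro j hj m hm
    rw [hC, Finset.mem_image]
    constructor
    · rintro ⟨i, -, hi⟩
      have h1 : (i * (2 * k) + (k - 1)) % (2 * k) = k - 1 := by
        rw [mul_comm, Nat.mul_add_mod, Nat.mod_eq_of_lt (by omega)]
      have h2 : (j * (2 * k) + m) % (2 * k) = m := by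
        rw [mul_comm, Nat.mul_add_mod, Nat.mod_eq_of_lt (by omega)]
      rw [← h2, ← hi, h1]
    · rintro rfl
      exact ⟨j, Finset.mem_range.2 hj, rfl⟩
  have hmem_mod : ∀ n ∈ C, n % (2 * k) = k - 1 ∧ n < J * (2 * k) := by
    intro n hn
    obtain ⟨i, hi, rfl⟩ := Finset.mem_image.1 hn
    have : (i + 1) * (2 * k) ≤ J * (2 * k) := Nat.mul_le_mul_right _ (Finset.mem_range.1 hi)
    have h3 : (i + 1) * (2 * k) = i * (2 * k) + 2 * k := by ring
    exact ⟨by rw [mul_comm, Nat.mul_add_mod, Nat.mod_eq_of_lt (by omega)], by omega⟩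
  have hres : ∀ s, ∀ j < J, ∀ i < k, dev X (j * (2 * k) + i) (resample C e s) =
      dev X i (Function.update (fun n => e (j * (2 * k) + n)) (k - 1)
        (s (j * (2 * k) + (k - 1)))) := by
    intro s j hj i hi
    rw [← dev_shift X]
    refine dependsOn_dev X (p := 2 * k) (by omega) fun m hm => ?_
    have hm' := hmem j hj m hm
    by_cases hmk : m = k - 1
    · rw [hmk] at hm' ⊢
      simp [resample, hm']
    · simp [resample, hm', hmk]
  have hfar : ∀ s n, (∀ i < k, n + i ∉ C) → dev X n (resample C e s) =
      dev X n (resample C e fun _ => false) := by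
    intro s n hn
    have : ∀ s, ∀ i : Fin k, resample C e s (n + i) = e (n + i) := fun s i => by
      simp [resample, hn i i.2]
    simp only [dev, this]
  rw [← sub_eq_iff_eq_add', ← Finset.sum_sub_distrib,
    ← Finset.sum_subset (Finset.range_subset_range.2 hM), sum_range_mul_eq, Finset.sum_range]
  · refine Finset.sum_congr rfl fun j _ => ?_
    have hz : ∑ i ∈ Finset.range k, (dev X (j * (2 * k) + (k + i)) (resample C e s) -
        dev X (j * (2 * k) + (k + i)) (resample C e fun _ => false)) = 0 := by
      refine Finset.sum_eq_zero fun i hi => ?_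
      have hi := Finset.mem_range.1 hi
      rw [hfar s _ fun i' hi' hmemC => ?_, sub_self]
      have h1 := (hmem_mod _ hmemC).1
      rw [mul_comm, add_assoc, Nat.mul_add_mod] at h1
      rcases lt_or_ge (k + i + i') (2 * k) with h2 | h2
      · rw [Nat.mod_eq_of_lt h2] at h1
        omega
      · rw [Nat.mod_eq_sub_mod h2, Nat.mod_eq_of_lt (by omega)] at h1
        omega
    rw [two_mul k, Finset.sum_range_add, ← two_mul k, hz, add_zero]
    have hsum : ∀ i ∈ Finset.range k, dev X (j * (2 * k) + i) (resample C e s) -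
        dev X (j * (2 * k) + i) (resample C e fun _ => false) =
        if s (j * (2 * k) + (k - 1)) then
          dev X i (Function.update (fun n => e (j * (2 * k) + n)) (k - 1) true) -
          dev X i (Function.update (fun n => e (j * (2 * k) + n)) (k - 1) false) else 0 := by
      intro i hi
      rw [hres s j j.2 i (Finset.mem_range.1 hi), hres _ j j.2 i (Finset.mem_range.1 hi)]
      cases s (j * (2 * k) + (k - 1)) <;> simp
    rw [Finset.sum_congr rfl hsum]
    split_ifs
    · rfl
    · simp
  · intro n _ hn
    rw [Finset.mem_range, not_lt] at hn
    rw [hfar s n fun i _ hi => absurd (hmem_mod _ hi).2 (by omega), sub_self]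

/-- Surroundings of a switch for which exactly one occurrence of `X` depends on it. -/
def switchPattern (m : Fin (2 * k)) : Bool :=
  if h : (m : ℕ) < k - 1 then X ⟨m, by omega⟩ else !X ⟨k - 1, by omega⟩

lemma abs_switchGain_eq_one (hk : 0 < k) {e : ℕ → Bool}
    (he : ∀ m : Fin (2 * k), e m = switchPattern X m) : |switchGain X e| = 1 := by
  have hlast : ∀ b, ∀ i ≠ 0, i < k → ¬ ∀ m : Fin k,
      Function.update e (k - 1) b (i + m) = X m := by
    intro b i hi0 hi h
    have h1 := h ⟨k - 1, by omega⟩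
    rw [Function.update_of_ne (by simp; omega)] at h1
    have h2 := he ⟨i + (k - 1), by omega⟩
    simp only [switchPattern] at h2
    rw [dif_neg (by omega)] at h2
    simp only at h1
    rw [h1] at h2
    simp at h2
  have hfirst : ∀ b, (∀ m : Fin k, Function.update e (k - 1) b (0 + m) = X m) ↔
      b = X ⟨k - 1, by omega⟩ := by
    intro b
    constructor
    · intro h
      simpa using h ⟨k - 1, by omega⟩
    · intro hb m
      by_cases hm : (m : ℕ) = k - 1
      · have : m = ⟨k - 1, by omega⟩ := Fin.ext hm
        rw [this, hb]
        simp
      · have h2 := he ⟨m, by omega⟩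
        simp only [switchPattern] at h2
        rw [dif_pos (by omega)] at h2
        simpa [hm] using h2
  rw [switchGain, Finset.sum_eq_single_of_mem 0 (Finset.mem_range.2 hk)]
  · simp only [dev, hfirst]
    cases X ⟨k - 1, by omega⟩
    · simp only [Bool.true_eq_false, if_false, if_true]
      rw [abs_eq zero_le_one]
      right
      ring
    · simp
  · intro i hi hi0
    simp only [dev, hlast _ i hi0 (Finset.mem_range.1 hi)]
    simp

lemma norm_exp_add_one_div_two (θ : ℝ) :
    ‖(Complex.exp (θ * Complex.I) + 1) / 2‖ = |Real.cos (θ / 2)| := by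
  have : (Complex.exp (θ * Complex.I) + 1) / 2 =
      Complex.exp ((θ / 2 : ℝ) * Complex.I) * (Real.cos (θ / 2) : ℝ) := by
    rw [Complex.ofReal_cos, Complex.cos, mul_div_assoc', mul_add, ← Complex.exp_add,
      ← Complex.exp_add]
    push_cast
    ring_nf
    simp
    ring
  rw [this, norm_mul, Complex.norm_exp_ofReal_mul_I, one_mul, Complex.norm_real, Real.norm_eq_abs]

lemma abs_cos_half_le {v : ℝ} (hv : |v| ≤ Real.pi) :
    |Real.cos (v / 2)| ≤ 1 - v ^ 2 / (2 * Real.pi ^ 2) := by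
  have hπ := Real.pi_pos
  have h1 : |v| / Real.pi ≤ Real.sin (|v| / 2) := by
    have := Real.mul_le_sin (x := |v| / 2) (by positivity) (by linarith)
    convert! this using 1
    field_simp
  have h2 : Real.cos (|v| / 2) = Real.cos (v / 2) := by
    rw [show |v| / 2 = |v / 2| by rw [abs_div]; norm_num, Real.cos_abs]
  have h3 := Real.sin_sq_add_cos_sq (|v| / 2)
  rw [h2, ← sq_abs (Real.cos _)] at h3
  have h4 : (|v| / Real.pi) ^ 2 ≤ Real.sin (|v| / 2) ^ 2 :=
    pow_le_pow_left₀ (by positivity) h1 2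
  have h5 := Real.abs_cos_le_one (v / 2)
  have h6 : v ^ 2 / (2 * Real.pi ^ 2) = (|v| / Real.pi) ^ 2 / 2 := by
    rw [div_pow, sq_abs]; field_simp
  rw [h6]
  nlinarith [abs_nonneg (Real.cos (v / 2))]

lemma integral_norm_switchGain_le (hk : 0 < k) {v : ℝ} (hv : |v| ≤ Real.pi) :
    ∫ e, ‖(Complex.exp (v * switchGain X e * Complex.I) + 1) / 2‖ ∂coinSeq ≤
      Real.exp (-(v ^ 2 / (2 * Real.pi ^ 2 * 4 ^ k))) := by
  have hcos := abs_cos_half_le hv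
  have hdev : Integrable (dev (switchPattern X) 0) coinSeq :=
    Integrable.of_bound (measurable_dev _ 0).aestronglyMeasurable 1
      (ae_of_all _ fun e => abs_dev_le _ 0 e)
  calc _ ≤ ∫ e, (1 - (dev (switchPattern X) 0 e + 1 / 2 ^ (2 * k)) *
        (v ^ 2 / (2 * Real.pi ^ 2))) ∂coinSeq := by
        refine integral_mono_of_nonneg (ae_of_all _ fun e => norm_nonneg _)
          ((integrable_const _).sub ((hdev.add (integrable_const _)).mul_const _))
          (ae_of_all _ fun e => ?_)
        simp only
        rw [← Complex.ofReal_mul, norm_exp_add_one_div_two]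
        simp only [dev, zero_add]
        split_ifs with he
        · have hgain : |Real.cos (v * switchGain X e / 2)| = |Real.cos (v / 2)| := by
            rcases (abs_eq zero_le_one).1 (abs_switchGain_eq_one X hk he) with h | h <;> rw [h]
            · rw [mul_one]
            · rw [mul_neg_one, neg_div, Real.cos_neg]
          rw [hgain]
          linarith
        · have := Real.abs_cos_le_one (v * switchGain X e / 2)
          linarith
    _ = 1 - v ^ 2 / (2 * Real.pi ^ 2 * 4 ^ k) := by
        have hadd : Integrable (fun e => dev (switchPattern X) 0 e + 1 / 2 ^ (2 * k)) coinSeq :=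
          hdev.add (integrable_const _)
        rw [integral_sub (integrable_const _) (hadd.mul_const _),
          integral_mul_const, integral_add hdev (integrable_const _), integral_dev]
        simp [pow_mul]
        field_simp
        norm_num
        ring
    _ ≤ _ := Real.one_sub_le_exp_neg _

/-- Anticoncentration for functionals of the pattern counts which are equivariant under shifting
all deviations after the switches by a common amount. -/
lemma exists_measureReal_equivariant_le (hk : 0 < k) {c δ : ℝ} (hc : 0 < c) (hδ : 0 < δ) :
    ∃ ε > 0, ∃ N₀ : ℕ, ∀ N ≥ N₀, ∀ J : ℕ, c * N ≤ J → ∀ Y : (ℕ → Bool) → ℝ, Measurable Y →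
      (∀ e e' D, (∀ M ≥ J * (2 * k), ∑ n ∈ Finset.range M, dev X n e =
        ∑ n ∈ Finset.range M, dev X n e' + D) → Y e = Y e' + D) →
      ∀ y, coinSeq.real {e | |Y e - y| ≤ ε * √N} ≤ δ := by
  have hπ := Real.pi_pos
  obtain ⟨ε, hε, N₀, h⟩ := exists_measureReal_abs_sub_le_le coinSeq
    (κ := c / (2 * Real.pi ^ 2 * 4 ^ k)) (by positivity) hδ
  refine ⟨ε, hε, N₀, fun N hN J hJ Y hY hequi y => h N hN Y hY (fun v hv => ?_) y⟩
  refine (norm_charFun_le_pow_of_switch (p := 2 * k) (J := J) (a := k - 1) (by omega)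
    (dependsOn_switchGain X) hY (fun e s => hequi _ _ _ fun M hM => sum_dev_resample X hk hM e s)
    (integral_norm_switchGain_le X hk hv)).trans ?_
  rw [← Real.exp_nat_mul, Real.exp_le_exp]
  have : c * N * (v ^ 2 / (2 * Real.pi ^ 2 * 4 ^ k)) ≤ J * (v ^ 2 / (2 * Real.pi ^ 2 * 4 ^ k)) :=
    mul_le_mul_of_nonneg_right hJ (by positivity)
  have h2 : c / (2 * Real.pi ^ 2 * 4 ^ k) * N * v ^ 2 =
    c * N * (v ^ 2 / (2 * Real.pi ^ 2 * 4 ^ k)) := by ring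
  rw [neg_mul, h2]
  linarith

end Switch

section Normality

/-- The deviation `T(E, M, X) - M / 2 ^ k`. -/
noncomputable def devSum {k : ℕ} (X : Fin k → Bool) (M : ℕ) (e : ℕ → Bool) : ℝ :=
  ∑ n ∈ Finset.range M, dev X n e

lemma abs_devSum_le {k : ℕ} (X : Fin k → Bool) (M : ℕ) (e : ℕ → Bool) : |devSum X M e| ≤ M := by
  refine (Finset.abs_sum_le_sum_abs _ _).trans
    ((Finset.sum_le_sum fun i _ => abs_dev_le X i e).trans ?_)
  simp

lemma measurable_devSum {k : ℕ} (X : Fin k → Bool) (M : ℕ) : Measurable (devSum X M) :=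
  Finset.measurable_fun_sum _ fun i _ => measurable_dev X i

lemma one_le_and_le_logb_iff {N k : ℕ} :
    (1 ≤ k ∧ (k : ℝ) ≤ Real.logb 2 N) ↔ (1 ≤ k ∧ 2 ^ k ≤ N) := by
  refine and_congr_right fun hk => ?_
  rcases Nat.eq_zero_or_pos N with rfl | hN
  · simp
    omega
  · rw [Real.le_logb_iff_rpow_le (by norm_num) (by exact_mod_cast hN), Real.rpow_natCast]
    exact_mod_cast Iff.rfl

lemma normality_eq (N : ℕ) (e : ℕ → Bool) :
    normality N e = sSup {x : ℝ | ∃ (k M : ℕ) (X : Fin k → Bool),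
      1 ≤ k ∧ 2 ^ k ≤ N ∧ 1 ≤ M ∧ M + k ≤ N + 1 ∧ x = |devSum X M e|} := by
  unfold normality devSum
  congr 1
  ext x
  simp only [Set.mem_ofPred_eq, patCount_sub]
  refine exists_congr fun k => exists_congr fun M => exists_congr fun X => ?_
  rw [← and_assoc, one_le_and_le_logb_iff, and_assoc]

lemma abs_devSum_le_normality {N k M : ℕ} (X : Fin k → Bool) (hk : 1 ≤ k) (hkN : 2 ^ k ≤ N)
    (hM : M + k ≤ N + 1) (e : ℕ → Bool) : |devSum X M e| ≤ normality N e := by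
  have hbdd : BddAbove {x : ℝ | ∃ (k M : ℕ) (X : Fin k → Bool),
      1 ≤ k ∧ 2 ^ k ≤ N ∧ 1 ≤ M ∧ M + k ≤ N + 1 ∧ x = |devSum X M e|} := by
    refine ⟨N, ?_⟩
    rintro _ ⟨k, M, X, hk, -, -, hM, rfl⟩
    refine (abs_devSum_le X M e).trans ?_
    exact_mod_cast (by omega : M ≤ N)
  rw [normality_eq]
  rcases Nat.eq_zero_or_pos M with rfl | hM0
  · simp only [devSum, Finset.range_zero, Finset.sum_empty, abs_zero]
    refine Real.sSup_nonneg ?_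
    rintro _ ⟨k, M, X, -, -, -, -, rfl⟩
    positivity
  · exact le_csSup hbdd ⟨k, M, X, hk, hkN, hM0, hM, rfl⟩

lemma normality_le {N : ℕ} {e : ℕ → Bool} {y : ℝ} (hy : 0 ≤ y)
    (h : ∀ (k M : ℕ) (X : Fin k → Bool), 1 ≤ k → 2 ^ k ≤ N → 1 ≤ M → M + k ≤ N + 1 →
      |devSum X M e| ≤ y) : normality N e ≤ y := by
  rw [normality_eq]
  refine Real.sSup_le ?_ hy
  rintro _ ⟨k, M, X, hk, hkN, hM0, hM, rfl⟩
  exact h k M X hk hkN hM0 hM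

lemma normality_nonneg (N : ℕ) (e : ℕ → Bool) : 0 ≤ normality N e := by
  rw [normality_eq]
  refine Real.sSup_nonneg ?_
  rintro _ ⟨k, M, X, -, -, -, -, rfl⟩
  positivity

lemma dependsOn_normality (N : ℕ) : DependsOn (normality N) (Set.Iio N) := by
  intro e e' hee
  rw [normality_eq, normality_eq]
  congr 1
  ext x
  refine exists_congr fun k => exists_congr fun M => exists_congr fun X => ?_
  refine and_congr_right fun _ => and_congr_right fun _ => and_congr_right fun _ =>
    and_congr_right fun hM => ?_
  have : devSum X M e = devSum X M e' := dependsOn_sum_dev X hM hee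
  rw [this]

lemma measurable_normality (N : ℕ) : Measurable (normality N) :=
  (dependsOn_normality N).measurable_of_Iio

end Normality

section Tail

/-- Long patterns do not contribute to the normality measure, uniformly in the length `N`. -/
lemma exists_measureReal_long_pattern_le {l η : ℝ} (hl : 0 < l) (hη : 0 < η) :
    ∃ K, 1 ≤ K ∧ ∀ N : ℕ, coinSeq.real {e | ∃ k > K, 2 ^ k ≤ N ∧ ∃ M ≤ N, ∃ X : Fin k → Bool,
      l * √N ≤ |devSum X M e|} ≤ η := by
  have hgeom : Summable fun k : ℕ => (k : ℝ) ^ 5 * (1 / 2) ^ k :=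
    summable_pow_mul_geometric_of_norm_lt_one 5 (r := (1 / 2 : ℝ)) (by norm_num)
  have hsum : Summable fun k : ℕ => 7 / l ^ 4 * ((k : ℝ) ^ 5 * (1 / 2) ^ k) :=
    hgeom.mul_left (7 / l ^ 4)
  obtain ⟨s, hs⟩ := summable_iff_vanishing_norm.1 hsum η hη
  obtain ⟨K, hK1, hKs⟩ : ∃ K, 1 ≤ K ∧ ∀ k ∈ s, k < K :=
    ⟨s.sup id + 1, by omega, fun k hk => Nat.lt_succ_of_le (Finset.le_sup (f := id) hk)⟩
  refine ⟨K, hK1, fun N => ?_⟩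
  rcases Nat.eq_zero_or_pos N with rfl | hN
  · have : {e : ℕ → Bool | ∃ k > K, 2 ^ k ≤ 0 ∧ ∃ M ≤ 0, ∃ X : Fin k → Bool,
      l * √(0 : ℕ) ≤ |devSum X M e|} = ∅ := by
      ext e
      simp
    rw [this]
    simpa using hη.le
  have hN' : (0 : ℝ) < N := by exact_mod_cast hN
  obtain ⟨T, hT⟩ : ∃ T : Finset ℕ, ∀ k, k ∈ T ↔ K < k ∧ 2 ^ k ≤ N := by
    refine ⟨(Finset.Ioc K N).filter fun k => 2 ^ k ≤ N, fun k => ?_⟩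
    have := Nat.lt_two_pow_self (n := k)
    simp only [Finset.mem_filter, Finset.mem_Ioc]
    exact ⟨fun h => ⟨h.1.1, h.2⟩, fun h => ⟨⟨h.1, by omega⟩, h.2⟩⟩
  have hsub : {e : ℕ → Bool | ∃ k > K, 2 ^ k ≤ N ∧ ∃ M ≤ N, ∃ X : Fin k → Bool,
      l * √N ≤ |devSum X M e|} ⊆
      ⋃ k ∈ T, ⋃ X ∈ (Finset.univ : Finset (Fin k → Bool)),
        {e | ∃ M ≤ N, l * √N ≤ |devSum X M e|} := by
    intro e he
    simp only [Set.mem_ofPred_eq] at he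
    obtain ⟨k, hk, hkN, M, hM, X, h⟩ := he
    refine Set.mem_biUnion ((hT k).2 ⟨hk, hkN⟩) ?_
    refine Set.mem_biUnion (Finset.mem_coe.2 (Finset.mem_univ X)) ?_
    simp only [Set.mem_ofPred_eq]
    exact ⟨M, hM, h⟩
  have hone : ∀ k ∈ T, ∀ X : Fin k → Bool,
      coinSeq.real {e | ∃ M ≤ N, l * √N ≤ |devSum X M e|} ≤
        7 / l ^ 4 * ((k : ℝ) ^ 5 * (1 / 2 ^ k) ^ 2) := by
    intro k hk X
    rw [hT] at hk
    have h := measureReal_exists_abs_sum_dev_ge_le X (by omega) 0 N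
      (l := l * √N) (by positivity)
    simp only [zero_add] at h
    refine h.trans ?_
    have hk2 : (2 : ℝ) ^ k ≤ N := by exact_mod_cast hk.2
    have hq : 1 / (N : ℝ) ≤ 1 / 2 ^ k := one_div_le_one_div_of_le (by positivity) hk2
    have hq0 : (0 : ℝ) < 1 / 2 ^ k := by positivity
    have h4 : (l * √N) ^ 4 = l ^ 4 * N ^ 2 := by
      rw [mul_pow, show (4 : ℕ) = 2 * 2 by rfl, pow_mul (√N), Real.sq_sqrt hN'.le]
    rw [h4]
    calc _ = (4 * (1 / 2 ^ k) ^ 2 + 3 * (1 / 2 ^ k) * (1 / N)) * k ^ 5 / l ^ 4 := by field_simp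
      _ ≤ (4 * (1 / 2 ^ k) ^ 2 + 3 * (1 / 2 ^ k) * (1 / 2 ^ k)) * k ^ 5 / l ^ 4 := by gcongr
      _ = _ := by ring
  have hdisj : Disjoint T s := by
    rw [Finset.disjoint_left]
    intro k hk hks
    have := hKs k hks
    have := ((hT k).1 hk).1
    omega
  calc _ ≤ _ := measureReal_mono hsub (measure_ne_top _ _)
    _ ≤ _ := measureReal_biUnion_finset_le _ _
    _ ≤ ∑ k ∈ T, 7 / l ^ 4 * ((k : ℝ) ^ 5 * (1 / 2) ^ k) := by
      refine Finset.sum_le_sum fun k hk => (measureReal_biUnion_finset_le _ _).trans ?_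
      refine (Finset.sum_le_sum fun X _ => hone k hk X).trans (le_of_eq ?_)
      rw [Finset.sum_const, Finset.card_univ, Fintype.card_fun, Fintype.card_bool,
        Fintype.card_fin, nsmul_eq_mul]
      push_cast
      rw [one_div_pow (2 : ℝ) k]
      field_simp
    _ ≤ _ := (le_abs_self _).trans (hs T hdisj).le

end Tail

section Approximation

/-- The patterns of length between `1` and `K`. -/
abbrev ShortPattern (K : ℕ) : Type := Σ k : Fin K, (Fin (k + 1) → Bool)

/-- The part of the deviation coming from occurrences well inside the `b`-th block of length `p`. -/
noncomputable def blockDev (K p b : ℕ) (e : ℕ → Bool) (X : ShortPattern K) : ℝ :=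
  ∑ i ∈ Finset.range (p - K), dev X.2 (b * p + i) e

/-- A discretised normality measure, which is a norm of sums of independent vectors. -/
noncomputable def blockMax (K p L q : ℕ) (e : ℕ → Bool) : ℝ :=
  ‖fun a : Fin L × ShortPattern K => ∑ b ∈ Finset.range (a.1 * q), blockDev K p b e a.2‖

lemma devSum_add {k : ℕ} (X : Fin k → Bool) (m n : ℕ) (e : ℕ → Bool) :
    devSum X (m + n) e = devSum X m e + ∑ i ∈ Finset.range n, dev X (m + i) e :=
  Finset.sum_range_add _ _ _

lemma devSum_mul {K p : ℕ} (hK : K ≤ p) (X : ShortPattern K) (m : ℕ) (e : ℕ → Bool) :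
    devSum X.2 (m * p) e = ∑ b ∈ Finset.range m, blockDev K p b e X +
      ∑ b ∈ Finset.range m, ∑ i ∈ Finset.range K, dev X.2 (p - K + b * p + i) e := by
  rw [devSum, sum_range_mul_eq, ← Finset.sum_add_distrib]
  refine Finset.sum_congr rfl fun b _ => ?_
  rw [blockDev, show Finset.range p = Finset.range (p - K + K) by rw [Nat.sub_add_cancel hK],
    Finset.sum_range_add]
  congr 1
  refine Finset.sum_congr rfl fun i _ => ?_
  congr 1
  ring

/-- On the event that long patterns, gaps between blocks and remainders are negligible, the
normality measure is close to its discretisation. -/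
lemma abs_normality_sub_blockMax_le {K p L N : ℕ} {e : ℕ → Bool} {x : ℝ}
    (hp0 : 0 < p) (hp : K ≤ p) (hL : 0 < L) (hN : L * p ≤ N) (hKN : 2 ^ K ≤ N)
    (h1 : ∀ k > K, 2 ^ k ≤ N → ∀ M ≤ N, ∀ X : Fin k → Bool, |devSum X M e| ≤ x)
    (h2 : ∀ X : ShortPattern K, ∀ m ≤ L * (N / (L * p)),
      |∑ b ∈ Finset.range m, ∑ i ∈ Finset.range K, dev X.2 (p - K + b * p + i) e| ≤ x)
    (h3 : ∀ X : ShortPattern K, ∀ j < L, ∀ m ≤ N / (L * p) * p + L * p,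
      |∑ n ∈ Finset.range m, dev X.2 (j * (N / (L * p)) * p + n) e| ≤ x) (hx : 0 ≤ x) :
    |normality N e - blockMax K p L (N / (L * p)) e| ≤ 2 * x := by
  have hLp : 0 < L * p := by positivity
  have hq1 : 1 ≤ N / (L * p) := (Nat.one_le_div_iff hLp).2 hN
  have hqN : L * p * (N / (L * p)) ≤ N := Nat.mul_div_le _ _
  have hqN' : N < L * p * (N / (L * p) + 1) := by
    have := Nat.lt_mul_div_succ N hLp
    exact this
  generalize N / (L * p) = q at *
  have hnorm0 : 0 ≤ blockMax K p L q e := norm_nonneg _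
  rw [abs_sub_le_iff]
  constructor
  · rw [sub_le_iff_le_add']
    refine normality_le (by positivity) fun k M X hk hkN hM1 hM => ?_
    rcases lt_or_ge K k with hkK | hkK
    · have := h1 k hkK hkN M (by omega) X
      linarith
    obtain ⟨k, rfl⟩ : ∃ k', k = k' + 1 := ⟨k - 1, by omega⟩
    obtain ⟨j, m, hj, hm, hjm⟩ : ∃ j m, j < L ∧ m ≤ q * p + L * p ∧ M = j * q * p + m := by
      rcases le_or_gt (L - 1) (M / (q * p)) with h | h
      · have hle : (L - 1) * (q * p) ≤ M := (Nat.le_div_iff_mul_le (by positivity)).1 h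
        refine ⟨L - 1, M - (L - 1) * q * p, by omega, ?_, by rw [mul_assoc]; omega⟩
        obtain ⟨l, rfl⟩ : ∃ l, L = l + 1 := ⟨L - 1, by omega⟩
        rw [Nat.add_sub_cancel] at *
        have : (l + 1) * p * (q + 1) = l * q * p + (q * p + (l + 1) * p) := by ring
        omega
      · refine ⟨M / (q * p), M % (q * p), by omega, ?_, ?_⟩
        · exact ((Nat.mod_lt _ (by positivity)).le).trans (by omega)
        · rw [mul_assoc, mul_comm (M / _), Nat.div_add_mod]
    have e1 := devSum_mul hp ⟨⟨k, by omega⟩, X⟩ (j * q) e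
    have e2 := h2 ⟨⟨k, by omega⟩, X⟩ (j * q) (Nat.mul_le_mul_right _ hj.le)
    have e3 := h3 ⟨⟨k, by omega⟩, X⟩ j hj m hm
    have e4 : |∑ b ∈ Finset.range (j * q), blockDev K p b e ⟨⟨k, by omega⟩, X⟩| ≤
        blockMax K p L q e := norm_le_pi_norm
      (fun a : Fin L × ShortPattern K => ∑ b ∈ Finset.range (a.1 * q), blockDev K p b e a.2)
      (⟨j, hj⟩, ⟨⟨k, by omega⟩, X⟩)
    dsimp only at e1 e2 e3
    rw [hjm, devSum_add, e1]
    refine (abs_add_le _ _).trans ?_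
    have := abs_add_le (∑ b ∈ Finset.range (j * q), blockDev K p b e ⟨⟨k, by omega⟩, X⟩)
      (∑ b ∈ Finset.range (j * q), ∑ i ∈ Finset.range K, dev X (p - K + b * p + i) e)
    linarith
  · rw [sub_le_iff_le_add']
    have hn := normality_nonneg N e
    refine (pi_norm_le_iff_of_nonneg (by positivity)).2 fun ⟨j, X⟩ => ?_
    have e1 := devSum_mul hp X (j * q) e
    have e2 := h2 X (j * q) (Nat.mul_le_mul_right _ j.2.le)
    have hjN : (j : ℕ) * q * p + (X.1 + 1) ≤ N + 1 := by
      obtain ⟨r, hr⟩ : ∃ r, L = j + 1 + r := ⟨L - (j + 1), by omega⟩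
      have hX := X.1.2
      have : L * p * q = j * q * p + p * q + r * p * q := by
        have := congrArg (· * p * q) hr
        rw [this]
        ring
      have : p ≤ p * q := Nat.le_mul_of_pos_right p hq1
      have : 0 ≤ r * p * q := Nat.zero_le _
      omega
    have e3 := abs_devSum_le_normality X.2 (by omega)
      ((Nat.pow_le_pow_right (by norm_num) (by have := X.1.2; omega)).trans hKN) hjN e
    rw [Real.norm_eq_abs]
    have := abs_sub (devSum X.2 (j * q * p) e)
      (∑ b ∈ Finset.range (j * q), ∑ i ∈ Finset.range K, dev X.2 (p - K + b * p + i) e)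
    rw [e1, add_sub_cancel_right, ← e1] at this
    linarith


lemma measureReal_exists_abs_sum_dev_short_le {K : ℕ} (X : ShortPattern K) (s m : ℕ) {l : ℝ}
    (hl : 0 < l) : coinSeq.real {e | ∃ M ≤ m, l ≤ |∑ n ∈ Finset.range M, dev X.2 (s + n) e|} ≤
      7 * K ^ 5 * m ^ 2 / l ^ 4 := by
  refine (measureReal_exists_abs_sum_dev_ge_le X.2 (Nat.succ_pos _) s m hl).trans ?_
  have hK : ((X.1 + 1 : ℕ) : ℝ) ≤ K := by exact_mod_cast X.1.2
  have h2 : (1 : ℝ) / 2 ^ ((X.1 : ℕ) + 1) ≤ 1 := by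
    rw [div_le_one (by positivity)]
    exact one_le_pow₀ (by norm_num)
  have h0 : (0 : ℝ) ≤ 1 / 2 ^ ((X.1 : ℕ) + 1) := by positivity
  have hm : (m : ℝ) ≤ m ^ 2 := by exact_mod_cast Nat.le_self_pow (by norm_num) m
  generalize (1 : ℝ) / 2 ^ ((X.1 : ℕ) + 1) = t at *
  have ht : t ^ 2 ≤ 1 := pow_le_one₀ h0 h2
  have : 4 * (m : ℝ) ^ 2 * t ^ 2 + 3 * m * t ≤ 7 * m ^ 2 := by
    nlinarith [mul_le_mul_of_nonneg_left ht (sq_nonneg (m : ℝ)),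
      mul_le_mul_of_nonneg_left h2 (Nat.cast_nonneg (α := ℝ) m)]
  calc _ ≤ (K : ℝ) ^ 5 * (7 * m ^ 2) / l ^ 4 := by gcongr
    _ = _ := by ring

lemma mul_sqrt_pow_four (l : ℝ) (N : ℕ) : (l * √N) ^ 4 = l ^ 4 * N ^ 2 := by
  rw [mul_pow, show (4 : ℕ) = 2 * 2 by rfl, pow_mul (√(N : ℝ)), Real.sq_sqrt (Nat.cast_nonneg N)]

lemma exists_nat_ge_div_le (C : ℝ) {ε : ℝ} (hε : 0 < ε) (a : ℕ) :
    ∃ n : ℕ, a ≤ n ∧ 0 < n ∧ C / n ≤ ε := by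
  have h := tendsto_const_div_atTop_nhds_zero_nat C
  obtain ⟨n, hn, hn'⟩ := ((h.eventually_le_const hε).and
    (eventually_ge_atTop (max a 1))).exists
  exact ⟨n, by omega, by omega, hn⟩

/-- The normality measure is, up to `ε * √N` with probability at least `1 - ε`, a fixed norm of
sums of independent vectors. -/
lemma exists_measureReal_abs_normality_sub_blockMax_le {ε : ℝ} (hε : 0 < ε) :
    ∃ K p L : ℕ, 0 < p ∧ K ≤ p ∧ 0 < L ∧ ∀ᶠ N : ℕ in atTop,
      coinSeq.real {e | ε < |normality N e / √N - blockMax K p L (N / (L * p)) e / √N|} ≤ ε := by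
  obtain ⟨l, hl, rfl⟩ : ∃ l, 0 < l ∧ ε = 2 * l := ⟨ε / 2, by positivity, by ring⟩
  obtain ⟨K, hK1, hK⟩ := exists_measureReal_long_pattern_le hl (η := 2 * l / 3) (by positivity)
  set c : ℝ := (Fintype.card (ShortPattern K) : ℝ) with hc
  have hc0 : 0 ≤ c := Nat.cast_nonneg _
  obtain ⟨p, hpK, hp0, hp⟩ := exists_nat_ge_div_le (c * (7 * K ^ 4 / l ^ 4))
    (ε := 2 * l / 3) (by positivity) (2 * K)
  obtain ⟨L, -, hL0, hL⟩ := exists_nat_ge_div_le (c * (28 * K ^ 5 / l ^ 4))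
    (ε := 2 * l / 3) (by positivity) 0
  refine ⟨K, p, L, hp0, by omega, hL0, ?_⟩
  filter_upwards [eventually_ge_atTop (L * L * p), eventually_ge_atTop (2 ^ K)] with N hLN hKN
  have hN0 : 0 < N := (by positivity : 0 < 2 ^ K).trans_le hKN
  have hN' : (0 : ℝ) < N := by exact_mod_cast hN0
  have hLp : 0 < L * p := by positivity
  have hN : L * p ≤ N := (Nat.mul_le_mul_right p (Nat.le_mul_of_pos_right L hL0)).trans hLN
  have hqN : L * p * (N / (L * p)) ≤ N := Nat.mul_div_le _ _
  have hl0 : 0 < l * √N := by positivity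
  set q := N / (L * p) with hq
  set B₁ := {e : ℕ → Bool | ∃ k > K, 2 ^ k ≤ N ∧ ∃ M ≤ N, ∃ X : Fin k → Bool,
      l * √N ≤ |devSum X M e|} with hB₁
  set B₂ := fun X : ShortPattern K => {e : ℕ → Bool | ∃ m ≤ L * q, l * √N ≤
    |∑ b ∈ Finset.range m, ∑ i ∈ Finset.range K, dev X.2 (p - K + b * p + i) e|} with hB₂
  set B₃ := fun (X : ShortPattern K) (j : ℕ) => {e : ℕ → Bool | ∃ m ≤ q * p + L * p, l * √N ≤
    |∑ n ∈ Finset.range m, dev X.2 (j * q * p + n) e|} with hB₃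
  have hsub : {e | 2 * l < |normality N e / √N - blockMax K p L q e / √N|} ⊆
      B₁ ∪ ((⋃ X ∈ Finset.univ, B₂ X) ∪ ⋃ X ∈ Finset.univ, ⋃ j ∈ Finset.range L, B₃ X j) := by
    intro e he
    by_contra hcon
    simp only [Set.mem_union, Set.mem_iUnion, not_or, not_exists, hB₁, hB₂, hB₃,
      Set.mem_ofPred_eq, not_and, not_le, Finset.mem_univ, Finset.mem_range,
      forall_true_left] at hcon
    simp only [Set.mem_ofPred_eq] at he
    obtain ⟨h1, h2, h3⟩ := hcon
    have := abs_normality_sub_blockMax_le (e := e) (x := l * √N) hp0 (by omega) hL0 hN hKN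
      (fun k hk hkN M hM X => (h1 k hk hkN M hM X).le) (fun X m hm => (h2 X m hm).le)
      (fun X j hj m hm => (h3 X j hj m hm).le) hl0.le
    rw [← sub_div, abs_div, abs_of_pos (Real.sqrt_pos.2 hN'), lt_div_iff₀ (Real.sqrt_pos.2 hN')]
      at he
    linarith
  have hP₂ : ∀ X ∈ (Finset.univ : Finset (ShortPattern K)),
      coinSeq.real (B₂ X) ≤ 7 * K ^ 4 / l ^ 4 / p := by
    intro X _
    refine (measureReal_exists_abs_sum_windows_ge_le X.2 (by have := X.1.2; omega) hpK _ _
      hl0).trans ?_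
    have h1 : ((L * q : ℕ) : ℝ) * p ≤ N := by
      have : L * q * p ≤ N := by rwa [mul_right_comm]
      exact_mod_cast this
    have hp1 : (1 : ℝ) ≤ p := by exact_mod_cast hp0
    rw [mul_sqrt_pow_four, div_div, div_le_div_iff₀ (by positivity) (by positivity)]
    calc 7 * ((L * q : ℕ) : ℝ) ^ 2 * K ^ 4 * (l ^ 4 * p)
        ≤ 7 * ((L * q : ℕ) : ℝ) ^ 2 * K ^ 4 * (l ^ 4 * p ^ 2) := by
          gcongr
          nlinarith
      _ = 7 * K ^ 4 * (l ^ 4 * (((L * q : ℕ) : ℝ) * p) ^ 2) := by ring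
      _ ≤ _ := by gcongr
  have hP₃ : ∀ X ∈ (Finset.univ : Finset (ShortPattern K)),
      coinSeq.real (⋃ j ∈ Finset.range L, B₃ X j) ≤ 28 * K ^ 5 / l ^ 4 / L := by
    intro X _
    have hL1 : (0 : ℝ) < L := by exact_mod_cast hL0
    have h1 : ((q * p + L * p : ℕ) : ℝ) * L ≤ 2 * N := by
      have : (q * p + L * p) * L ≤ 2 * N := by
        calc (q * p + L * p) * L = L * p * q + L * L * p := by ring
          _ ≤ _ := by omega
      exact_mod_cast this
    have hone : ∀ j ∈ Finset.range L, coinSeq.real (B₃ X j) ≤ 28 * K ^ 5 / l ^ 4 / L ^ 2 := by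
      intro j _
      refine (measureReal_exists_abs_sum_dev_short_le X _ _ hl0).trans ?_
      rw [mul_sqrt_pow_four, div_div, div_le_div_iff₀ (by positivity) (by positivity)]
      calc 7 * (K : ℝ) ^ 5 * ((q * p + L * p : ℕ) : ℝ) ^ 2 * (l ^ 4 * L ^ 2)
          = 7 * (K : ℝ) ^ 5 * (l ^ 4 * (((q * p + L * p : ℕ) : ℝ) * L) ^ 2) := by ring
        _ ≤ 7 * (K : ℝ) ^ 5 * (l ^ 4 * (2 * N) ^ 2) := by gcongr
        _ = _ := by ring
    refine (measureReal_biUnion_finset_le _ _).trans ((Finset.sum_le_sum hone).trans (le_of_eq ?_))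
    rw [Finset.sum_const, Finset.card_range, nsmul_eq_mul]
    field_simp
  calc _ ≤ _ := measureReal_mono hsub (measure_ne_top _ _)
    _ ≤ _ := measureReal_union_le _ _
    _ ≤ _ := add_le_add_right (measureReal_union_le _ _) _
    _ ≤ 2 * l / 3 + (2 * l / 3 + 2 * l / 3) := by
      refine add_le_add (hK N) (add_le_add ?_ ?_)
      · refine (measureReal_biUnion_finset_le _ _).trans ((Finset.sum_le_sum hP₂).trans ?_)
        rwa [Finset.sum_const, Finset.card_univ, nsmul_eq_mul, ← hc, ← mul_div_assoc]
      · refine (measureReal_biUnion_finset_le _ _).trans ((Finset.sum_le_sum hP₃).trans ?_)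
        rwa [Finset.sum_const, Finset.card_univ, nsmul_eq_mul, ← hc, ← mul_div_assoc]
    _ = _ := by ring

end Approximation

section Limit

lemma blockDev_eq (K p b : ℕ) (e : ℕ → Bool) (X : ShortPattern K) :
    blockDev K p b e X = ∑ i ∈ Finset.range (p - K), dev X.2 i fun n => e (b * p + n) := by
  simp only [dev_shift, blockDev]

lemma measurable_blockDev (K p b : ℕ) : Measurable (blockDev K p b) :=
  measurable_pi_lambda _ fun _ => Finset.measurable_fun_sum _ fun _ _ => measurable_dev _ _

lemma measurable_blockMax (K p L q : ℕ) : Measurable (blockMax K p L q) := by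
  refine Measurable.norm (f := fun e (a : Fin L × ShortPattern K) =>
    ∑ b ∈ Finset.range (a.1 * q), blockDev K p b e a.2) (measurable_pi_lambda _ fun a => ?_)
  exact Finset.measurable_fun_sum _ fun b _ =>
    (measurable_pi_apply a.2).comp (measurable_blockDev K p b)

lemma iIndepFun_blockDev {K p : ℕ} (hp : K ≤ p) : iIndepFun (blockDev K p) coinSeq := by
  have hG : DependsOn (fun (e : ℕ → Bool) (X : ShortPattern K) =>
      ∑ i ∈ Finset.range (p - K), dev X.2 i e) (Set.Iio p) := fun e e' hee => by
    funext X
    exact dependsOn_sum_dev X.2 (by have := X.1.2; omega) hee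
  convert! hG.iIndepFun_shift 0 using 3 with b e
  funext X
  rw [blockDev_eq, zero_add]

lemma identDistrib_blockDev (K p b : ℕ) :
    IdentDistrib (blockDev K p b) (blockDev K p 0) coinSeq coinSeq where
  aemeasurable_fst := (measurable_blockDev K p b).aemeasurable
  aemeasurable_snd := (measurable_blockDev K p 0).aemeasurable
  map_eq := by
    conv_rhs => rw [← map_shift_coinSeq (b * p)]
    rw [Measure.map_map (measurable_blockDev K p 0)
      (measurable_pi_lambda _ fun a => measurable_pi_apply _)]
    congr 1
    funext e X
    simp [blockDev_eq]

lemma blockMax_div_sqrt (K p L q N : ℕ) (e : ℕ → Bool) :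
    blockMax K p L q e / √N = ‖fun a : Fin L × ShortPattern K => ∑ l : Fin L,
      if l < a.1 then (√N)⁻¹ * ∑ b ∈ Finset.range q, blockDev K p (l * q + b) e a.2 else 0‖ := by
  rw [blockMax, div_eq_inv_mul, ← abs_of_nonneg (inv_nonneg.2 (Real.sqrt_nonneg (N : ℝ))),
    ← Real.norm_eq_abs, ← norm_smul, Real.norm_eq_abs,
    abs_of_nonneg (inv_nonneg.2 (Real.sqrt_nonneg (N : ℝ)))]
  congr 1
  funext a
  simp only [Pi.smul_apply, smul_eq_mul]
  rw [sum_range_mul_eq, Finset.mul_sum]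
  have h := Fin.sum_univ_eq_sum_range (fun l => if l < (a.1 : ℕ) then
    (√(N : ℝ))⁻¹ * ∑ b ∈ Finset.range q, blockDev K p (l * q + b) e a.2 else 0) L
  simp only [Fin.lt_def]
  rw [h, ← Finset.sum_filter]
  refine Finset.sum_congr ?_ fun _ _ => rfl
  ext l
  have := a.1.2
  simp only [Finset.mem_range, Finset.mem_filter]
  omega

lemma exists_tendsto_integral_blockMax {K p L : ℕ} (hp0 : 0 < p) (hp : K ≤ p) (hL : 0 < L)
    {f : ℝ → ℝ} (hf : Continuous f) {B : ℝ} (hB : ∀ x, |f x| ≤ B) :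
    ∃ ℓ, Tendsto (fun N : ℕ => ∫ e, f (blockMax K p L (N / (L * p)) e / √N) ∂coinSeq)
      atTop (𝓝 ℓ) := by
  have hLp : (0 : ℝ) < (L * p : ℕ) := by positivity
  have hq : Tendsto (fun N : ℕ => ((N / (L * p) : ℕ) : ℝ) / N) atTop (𝓝 ((L * p : ℕ) : ℝ)⁻¹) := by
    have h := (tendsto_nat_floor_mul_div_atTop (R := ℝ) (inv_nonneg.2 hLp.le)).comp
      tendsto_natCast_atTop_atTop
    refine h.congr fun N => ?_
    simp only [Function.comp]
    rw [inv_mul_eq_div, Nat.floor_div_eq_div]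
  have hbd : ∀ e X, |blockDev K p 0 e X| ≤ (p - K : ℕ) := fun e X => by
    refine (Finset.abs_sum_le_sum_abs _ _).trans
      ((Finset.sum_le_sum fun i _ => abs_dev_le _ _ e).trans ?_)
    simp
  have hmean : ∀ X, ∫ e, blockDev K p 0 e X ∂coinSeq = 0 := fun X => by
    simp only [blockDev]
    rw [integral_finsetSum _ fun i _ => Integrable.of_bound
      (measurable_dev _ _).aestronglyMeasurable 1 (ae_of_all _ fun e => abs_dev_le _ _ e)]
    simp [integral_dev]
  have hcont : Continuous fun w : Fin L × ShortPattern K → ℝ =>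
      f ‖fun a : Fin L × ShortPattern K => ∑ l : Fin L, if l < a.1 then w (l, a.2) else 0‖ := by
    refine hf.comp (continuous_pi fun a => continuous_finsetSum _ fun l _ => ?_).norm
    split_ifs
    · exact continuous_apply _
    · exact continuous_const
  obtain ⟨ℓ, hℓ⟩ := exists_tendsto_integral_block_sums (iIndepFun_blockDev hp)
    (identDistrib_blockDev K p) hbd hmean hq hcont fun _ => hB _
  refine ⟨ℓ, ?_⟩
  simpa only [blockMax_div_sqrt] using hℓ

/-- Integrals of Lipschitz bounded functions of the normalised normality measure converge. -/
lemma exists_tendsto_integral_normality {f : ℝ → ℝ} {A : NNReal} (hf : LipschitzWith A f) {B : ℝ}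
    (hB : ∀ x, |f x| ≤ B) :
    ∃ ℓ, Tendsto (fun N : ℕ => ∫ e, f (normality N e / √N) ∂coinSeq) atTop (𝓝 ℓ) := by
  have hB0 : 0 ≤ B := (abs_nonneg _).trans (hB 0)
  have hZm : ∀ N, Measurable fun e => normality N e / √N := fun N =>
    (measurable_normality N).div_const _
  have h_int : ∀ {g : (ℕ → Bool) → ℝ}, Measurable g → Integrable (fun e => f (g e)) coinSeq :=
    fun hg => Integrable.of_bound
      (hf.continuous.measurable.comp hg).aestronglyMeasurable B (ae_of_all _ fun e => hB _)
  have key : ∀ ε > 0, ∃ u : ℕ → ℝ, (∃ ℓ, Tendsto u atTop (𝓝 ℓ)) ∧ ∀ᶠ N in atTop,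
      |(∫ e, f (normality N e / √N) ∂coinSeq) - u N| ≤ (A + 2 * B) * ε := by
    intro ε hε
    obtain ⟨K, p, L, hp0, hp, hL, h⟩ := exists_measureReal_abs_normality_sub_blockMax_le hε
    refine ⟨_, exists_tendsto_integral_blockMax hp0 hp hL hf.continuous hB, ?_⟩
    filter_upwards [h] with N hN
    have hYm : Measurable fun e => blockMax K p L (N / (L * p)) e / √N :=
      (measurable_blockMax _ _ _ _).div_const _
    rw [← integral_sub (h_int (hZm N)) (h_int hYm)]
    set S := {e | ε < |normality N e / √N - blockMax K p L (N / (L * p)) e / √N|} with hS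
    have hSm : MeasurableSet S := measurableSet_lt measurable_const ((hZm N).sub hYm).abs
    have hpt : ∀ e, |f (normality N e / √N) - f (blockMax K p L (N / (L * p)) e / √N)| ≤
        A * ε + 2 * B * S.indicator 1 e := by
      intro e
      by_cases he : e ∈ S
      · have h1 := abs_sub (f (normality N e / √N)) (f (blockMax K p L (N / (L * p)) e / √N))
        have h2 := hB (normality N e / √N)
        have h3 := hB (blockMax K p L (N / (L * p)) e / √N)
        have h4 : 0 ≤ A * ε := by positivity
        simp only [Set.indicator_of_mem he, Pi.one_apply]
        linarith
      · simp only [Set.indicator_of_notMem he, mul_zero, add_zero]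
        refine (hf.dist_le_mul _ _).trans ?_
        have : |normality N e / √N - blockMax K p L (N / (L * p)) e / √N| ≤ ε := not_lt.1 he
        rw [Real.dist_eq]
        gcongr
    have hi' : Integrable (fun e => 2 * B * S.indicator (1 : (ℕ → Bool) → ℝ) e) coinSeq :=
      ((integrable_const (1 : ℝ)).indicator hSm).const_mul _
    have hi : Integrable (fun e => A * ε + 2 * B * S.indicator (1 : (ℕ → Bool) → ℝ) e) coinSeq :=
      (integrable_const _).add hi'
    calc _ ≤ ∫ e, |f (normality N e / √N) - f (blockMax K p L (N / (L * p)) e / √N)| ∂coinSeq :=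
          abs_integral_le_integral_abs
      _ ≤ ∫ e, A * ε + 2 * B * S.indicator (1 : (ℕ → Bool) → ℝ) e ∂coinSeq :=
          integral_mono ((h_int (hZm N)).sub (h_int hYm)).abs hi hpt
      _ = A * ε + 2 * B * coinSeq.real S := by
          rw [integral_add (integrable_const _) hi', integral_const_mul (2 * B),
            integral_indicator_one hSm]
          simp
      _ ≤ A * ε + 2 * B * ε := by gcongr
      _ = _ := by ring
  refine cauchySeq_tendsto_of_complete (Metric.cauchySeq_iff'.2 fun δ hδ => ?_)
  obtain ⟨u, ⟨ℓ, hℓ⟩, hu⟩ := key (δ / (8 * (A + 2 * B + 1))) (by positivity)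
  have hb : (A + 2 * B) * (δ / (8 * (A + 2 * B + 1))) ≤ δ / 8 := by
    rw [mul_div_assoc', div_le_div_iff₀ (by positivity) (by positivity)]
    have : 0 ≤ δ * 8 := by positivity
    nlinarith
  obtain ⟨N₀, hN₀⟩ := eventually_atTop.1
    (hu.and (Metric.tendsto_nhds.1 hℓ (δ / 8) (by positivity)))
  refine ⟨N₀, fun n hn => ?_⟩
  have h1 := hN₀ n hn
  have h2 := hN₀ N₀ le_rfl
  rw [Real.dist_eq] at h1 h2 ⊢
  rw [abs_lt]
  have h5 := abs_le.1 h1.1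
  have h6 := abs_le.1 h2.1
  have h3 := abs_lt.1 h1.2
  have h4 := abs_lt.1 h2.2
  constructor <;> linarith [h3.1, h3.2, h4.1, h4.2, h5.1, h5.2, h6.1, h6.2]

end Limit

section Anticoncentration

/-- The largest deviation of the count of `X` over the times `s, …, s + m`. -/
noncomputable def devMax {k : ℕ} (X : Fin k → Bool) (s m : ℕ) (e : ℕ → Bool) : ℝ :=
  (Finset.range (m + 1)).sup' Finset.nonempty_range_add_one fun i => devSum X (s + i) e

/-- The smallest deviation of the count of `X` over the times `s, …, s + m`. -/
noncomputable def devMin {k : ℕ} (X : Fin k → Bool) (s m : ℕ) (e : ℕ → Bool) : ℝ :=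
  -(Finset.range (m + 1)).sup' Finset.nonempty_range_add_one fun i => -devSum X (s + i) e

lemma measurable_devMax {k : ℕ} (X : Fin k → Bool) (s m : ℕ) : Measurable (devMax X s m) := by
  have h := Finset.measurable_sup' (f := fun i e => devSum X (s + i) e)
    (Finset.nonempty_range_add_one (n := m)) fun i _ => measurable_devSum X (s + i)
  convert! h using 1
  funext e
  rw [devMax, Finset.sup'_apply]

lemma measurable_devMin {k : ℕ} (X : Fin k → Bool) (s m : ℕ) : Measurable (devMin X s m) := by
  have h := (Finset.measurable_sup' (f := fun i e => -devSum X (s + i) e)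
    (Finset.nonempty_range_add_one (n := m)) fun i _ => (measurable_devSum X (s + i)).neg).neg
  convert! h using 1
  funext e
  rw [devMin, Pi.neg_apply, Finset.sup'_apply]

lemma devMax_eq_add {k : ℕ} (X : Fin k → Bool) {s : ℕ} {e e' : ℕ → Bool} {D : ℝ}
    (h : ∀ M ≥ s, devSum X M e = devSum X M e' + D) (m : ℕ) :
    devMax X s m e = devMax X s m e' + D := by
  rw [devMax, devMax, Finset.sup'_add]
  exact Finset.sup'_congr _ rfl fun i _ => h _ (by omega)

lemma devMin_eq_add {k : ℕ} (X : Fin k → Bool) {s : ℕ} {e e' : ℕ → Bool} {D : ℝ}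
    (h : ∀ M ≥ s, devSum X M e = devSum X M e' + D) (m : ℕ) :
    devMin X s m e = devMin X s m e' + D := by
  rw [devMin, devMin, ← neg_neg D, ← neg_add, Finset.sup'_add]
  refine congrArg _ (Finset.sup'_congr _ rfl fun i _ => ?_)
  rw [h _ (by omega)]
  ring

/-- The extremal deviations over the times `s, …, s + m` with `s` proportional to `N` do not
concentrate on the scale `√N`. -/
lemma exists_measureReal_devMax_devMin_le {k : ℕ} (X : Fin k → Bool) (hk : 0 < k) {r : ℕ}
    (hr : 0 < r) {δ : ℝ} (hδ : 0 < δ) : ∃ ε > 0, ∀ᶠ N : ℕ in atTop, ∀ m y,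
      coinSeq.real {e | |devMax X (N / r) m e - y| ≤ ε * √N} ≤ δ ∧
      coinSeq.real {e | |devMin X (N / r) m e - y| ≤ ε * √N} ≤ δ := by
  have hrk : 0 < r * (2 * k) := by positivity
  have hrk' : (0 : ℝ) < (r * (2 * k) : ℕ) := by exact_mod_cast hrk
  obtain ⟨ε, hε, N₀, h⟩ := exists_measureReal_equivariant_le X hk
    (c := 1 / (2 * (r * (2 * k) : ℕ))) (by positivity) hδ
  refine ⟨ε, hε, ?_⟩
  filter_upwards [eventually_ge_atTop N₀, eventually_ge_atTop (2 * (r * (2 * k)))] with N hN hN2 m y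
  have hJ : 1 / (2 * (r * (2 * k) : ℕ)) * (N : ℝ) ≤ (N / (r * (2 * k)) : ℕ) := by
    have h1 : N < r * (2 * k) * (N / (r * (2 * k)) + 1) := Nat.lt_mul_div_succ N hrk
    have h2 : N ≤ 2 * (r * (2 * k)) * (N / (r * (2 * k))) := by
      generalize r * (2 * k) = w at *
      rw [mul_assoc]
      rw [mul_add] at h1
      omega
    rw [one_div, inv_mul_le_iff₀ (by positivity)]
    exact_mod_cast h2
  have hJs : N / (r * (2 * k)) * (2 * k) ≤ N / r := by
    rw [← Nat.div_div_eq_div_mul]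
    exact Nat.div_mul_le_self _ _
  exact ⟨h N hN _ hJ _ (measurable_devMax X _ m)
      (fun e e' D hD => devMax_eq_add X (fun M hM => hD M (hJs.trans hM)) m) y,
    h N hN _ hJ _ (measurable_devMin X _ m)
      (fun e e' D hD => devMin_eq_add X (fun M hM => hD M (hJs.trans hM)) m) y⟩

lemma exists_lt_abs_devSum {N : ℕ} {e : ℕ → Bool} {y : ℝ} (hy : 0 ≤ y) (h : y < normality N e) :
    ∃ (k M : ℕ) (X : Fin k → Bool), 1 ≤ k ∧ 2 ^ k ≤ N ∧ 1 ≤ M ∧ M + k ≤ N + 1 ∧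
      y < |devSum X M e| := by
  by_contra! hcon
  exact absurd (normality_le hy hcon) (not_le.2 h)


lemma measureReal_exists_short_pattern_le (K s N : ℕ) {l : ℝ} (hl : 0 < l) (hN : 0 < N) :
    coinSeq.real {e | ∃ X : ShortPattern K, ∃ M ≤ s, l * √N ≤ |devSum X.2 M e|} ≤
      Fintype.card (ShortPattern K) * (7 * K ^ 5 / l ^ 4) * (s / N) ^ 2 := by
  have hN' : (0 : ℝ) < N := by exact_mod_cast hN
  have hsub : {e : ℕ → Bool | ∃ X : ShortPattern K, ∃ M ≤ s, l * √N ≤ |devSum X.2 M e|} ⊆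
      ⋃ X ∈ (Finset.univ : Finset (ShortPattern K)),
        {e | ∃ M ≤ s, l * √N ≤ |∑ n ∈ Finset.range M, dev X.2 (0 + n) e|} := by
    rintro e ⟨X, M, hM, h⟩
    refine Set.mem_biUnion (Finset.mem_coe.2 (Finset.mem_univ X)) ⟨M, hM, ?_⟩
    simpa only [zero_add, devSum] using h
  refine (measureReal_mono hsub (measure_ne_top _ _)).trans
    ((measureReal_biUnion_finset_le _ _).trans ((Finset.sum_le_sum fun X _ =>
      measureReal_exists_abs_sum_dev_short_le X 0 s (by positivity)).trans (le_of_eq ?_)))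
  rw [Finset.sum_const, Finset.card_univ, nsmul_eq_mul, mul_sqrt_pow_four]
  field_simp

/-- The normalised normality measure does not concentrate at a positive level. -/
lemma exists_measureReal_abs_normality_sub_le_of_pos {t δ : ℝ} (ht : 0 < t) (hδ : 0 < δ) :
    ∃ ε > 0, ∀ᶠ N : ℕ in atTop, coinSeq.real {e | |normality N e / √N - t| ≤ ε} ≤ δ := by
  obtain ⟨K, hK1, hK⟩ := exists_measureReal_long_pattern_le (l := t / 2) (half_pos ht)
    (η := δ / 4) (by positivity)
  have hcpos : (0 : ℝ) < Fintype.card (ShortPattern K) :=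
    Nat.cast_pos.2 (Fintype.card_pos_iff.2 ⟨⟨⟨0, hK1⟩, fun _ => true⟩⟩)
  set c : ℝ := (Fintype.card (ShortPattern K) : ℝ) with hc
  obtain ⟨r, hr2, hr0, hr⟩ := exists_nat_ge_div_le (c * (7 * K ^ 5 / (t / 2) ^ 4))
    (ε := δ / 4) (by positivity) 2
  have hX : ∀ X : ShortPattern K, ∃ ε > 0, ∀ᶠ N : ℕ in atTop, ∀ m y,
      coinSeq.real {e | |devMax X.2 (N / r) m e - y| ≤ ε * √N} ≤ δ / (4 * c) ∧
      coinSeq.real {e | |devMin X.2 (N / r) m e - y| ≤ ε * √N} ≤ δ / (4 * c) := fun X =>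
    exists_measureReal_devMax_devMin_le X.2 (Nat.succ_pos _) hr0 (by positivity)
  choose ε' hε' hX' using hX
  have hev : ∀ᶠ ε in 𝓝[>] (0 : ℝ), (0 < ε ∧ 4 * ε < t) ∧ ∀ X, 2 * ε < ε' X := by
    refine Eventually.and ?_ (eventually_all.2 fun X => ?_)
    · filter_upwards [Ioo_mem_nhdsGT (show 0 < t / 4 by positivity)] with ε h
      exact ⟨h.1, by linarith [h.2]⟩
    · filter_upwards [Ioo_mem_nhdsGT (show 0 < ε' X / 2 by have := hε' X; positivity)] with ε h
      linarith [h.2]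
  obtain ⟨ε, ⟨hε, hεt⟩, hεX⟩ := hev.exists
  refine ⟨ε, hε, ?_⟩
  filter_upwards [eventually_all.2 hX', eventually_ge_atTop 1, eventually_ge_atTop (2 * K)]
    with N hXN hN1 hNK
  have hN' : (0 : ℝ) < N := by exact_mod_cast hN1
  have hsN : 0 < √(N : ℝ) := Real.sqrt_pos.2 hN'
  set s := N / r with hs
  have hsr : s * r ≤ N := Nat.div_mul_le_self N r
  have hs2 : s * 2 ≤ N := (Nat.mul_le_mul_left s hr2).trans hsr
  have hsub : {e | |normality N e / √N - t| ≤ ε} ⊆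
      {e | ∃ k > K, 2 ^ k ≤ N ∧ ∃ M ≤ N, ∃ X : Fin k → Bool, t / 2 * √N ≤ |devSum X M e|} ∪
      ({e | ∃ X : ShortPattern K, ∃ M ≤ s, t / 2 * √N ≤ |devSum X.2 M e|} ∪
      ((⋃ X ∈ (Finset.univ : Finset (ShortPattern K)),
          {e | |devMax X.2 s (N - X.1 - s) e - t * √N| ≤ ε' X * √N}) ∪
        ⋃ X ∈ (Finset.univ : Finset (ShortPattern K)),
          {e | |devMin X.2 s (N - X.1 - s) e - -(t * √N)| ≤ ε' X * √N})) := by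
    intro e he
    simp only [Set.mem_ofPred_eq] at he
    have h1 : (t - 2 * ε) * √N < normality N e := by
      rw [← lt_div_iff₀ hsN]
      linarith [(abs_le.1 he).1]
    have h2 : normality N e ≤ (t + ε) * √N := by
      rw [← div_le_iff₀ hsN]
      linarith [(abs_le.1 he).2]
    obtain ⟨k, M, X, hk, hkN, hM1, hM, h3⟩ := exists_lt_abs_devSum
      (mul_nonneg (by linarith) hsN.le) h1
    have h4 : t / 2 * √N ≤ |devSum X M e| := by nlinarith
    rcases lt_or_ge K k with hkK | hkK
    · exact Or.inl ⟨k, hkK, hkN, M, by omega, X, h4⟩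
    obtain ⟨k, rfl⟩ : ∃ k', k = k' + 1 := ⟨k - 1, by omega⟩
    refine Or.inr ?_
    rcases le_or_gt M s with hMs | hMs
    · exact Or.inl ⟨⟨⟨k, by omega⟩, X⟩, M, hMs, h4⟩
    refine Or.inr ?_
    have hup : ∀ i ∈ Finset.range (N - k - s + 1), |devSum X (s + i) e| ≤ (t + ε) * √N := by
      intro i hi
      have := Finset.mem_range.1 hi
      exact (abs_devSum_le_normality X hk hkN (by omega) e).trans h2
    have hmem : M - s ∈ Finset.range (N - k - s + 1) := Finset.mem_range.2 (by omega)
    have hMs' : s + (M - s) = M := by omega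
    have hεε : 2 * ε * √N ≤ ε' ⟨⟨k, by omega⟩, X⟩ * √N := by
      have := (hεX ⟨⟨k, by omega⟩, X⟩).le
      gcongr
    rcases le_total 0 (devSum X M e) with h0 | h0
    · refine Or.inl (Set.mem_biUnion (Finset.mem_coe.2 (Finset.mem_univ ⟨⟨k, by omega⟩, X⟩)) ?_)
      rw [abs_of_nonneg h0] at h3
      simp only [Set.mem_ofPred_eq]
      refine (abs_le.2 ⟨?_, ?_⟩).trans hεε
      · have h5 : devSum X (s + (M - s)) e ≤ devMax X s (N - k - s) e :=
          Finset.le_sup' (fun i => devSum X (s + i) e) hmem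
        rw [hMs'] at h5
        linarith
      · have h5 : devMax X s (N - k - s) e ≤ (t + ε) * √N :=
          Finset.sup'_le _ _ fun i hi => (abs_le.1 (hup i hi)).2
        nlinarith
    · refine Or.inr (Set.mem_biUnion (Finset.mem_coe.2 (Finset.mem_univ ⟨⟨k, by omega⟩, X⟩)) ?_)
      rw [abs_of_nonpos h0] at h3
      simp only [Set.mem_ofPred_eq]
      refine (abs_le.2 ⟨?_, ?_⟩).trans hεε
      · have h5 : -devMin X s (N - k - s) e ≤ (t + ε) * √N := by
          rw [devMin, neg_neg]
          exact Finset.sup'_le _ _ fun i hi => neg_le.1 (abs_le.1 (hup i hi)).1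
        nlinarith
      · have h5 : -devSum X (s + (M - s)) e ≤ -devMin X s (N - k - s) e := by
          rw [devMin, neg_neg]
          exact Finset.le_sup' (fun i => -devSum X (s + i) e) hmem
        rw [hMs'] at h5
        linarith
  have hP2 : coinSeq.real {e | ∃ X : ShortPattern K, ∃ M ≤ s, t / 2 * √N ≤ |devSum X.2 M e|} ≤
      δ / 4 := by
    refine (measureReal_exists_short_pattern_le K s N (half_pos ht) hN1).trans ?_
    refine le_trans ?_ hr
    rw [div_eq_mul_one_div _ (r : ℝ), ← hc]
    have hr' : (0 : ℝ) < r := by exact_mod_cast hr0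
    have h1 : (s : ℝ) / N ≤ 1 / r := by
      rw [div_le_div_iff₀ hN' hr', one_mul]
      exact_mod_cast hsr
    have h2 : (1 : ℝ) / r ≤ 1 := by
      rw [div_le_one hr']
      exact_mod_cast hr0
    have h3 : ((s : ℝ) / N) ^ 2 ≤ 1 / r := by
      have : 0 ≤ (s : ℝ) / N := by positivity
      nlinarith
    gcongr
  have hsumc : ∑ _X : ShortPattern K, δ / (4 * c) = δ / 4 := by
    rw [Finset.sum_const, Finset.card_univ, nsmul_eq_mul, ← hc]
    field_simp
  calc _ ≤ _ := measureReal_mono hsub (measure_ne_top _ _)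
    _ ≤ _ := measureReal_union_le _ _
    _ ≤ _ := add_le_add_right (measureReal_union_le _ _) _
    _ ≤ _ := add_le_add_right (add_le_add_right (measureReal_union_le _ _) _) _
    _ ≤ δ / 4 + (δ / 4 + (δ / 4 + δ / 4)) := by
      refine add_le_add (hK N) (add_le_add hP2 (add_le_add ?_ ?_))
      · exact (measureReal_biUnion_finset_le _ _).trans ((Finset.sum_le_sum fun X _ =>
          (hXN X _ _).1).trans hsumc.le)
      · exact (measureReal_biUnion_finset_le _ _).trans ((Finset.sum_le_sum fun X _ =>
          (hXN X _ _).2).trans hsumc.le)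
    _ = δ := by ring

/-- The normalised normality measure does not concentrate at any level. -/
lemma exists_measureReal_abs_normality_sub_le {t δ : ℝ} (ht : 0 ≤ t) (hδ : 0 < δ) :
    ∃ ε > 0, ∀ᶠ N : ℕ in atTop, coinSeq.real {e | |normality N e / √N - t| ≤ ε} ≤ δ := by
  rcases ht.lt_or_eq with ht | rfl
  · exact exists_measureReal_abs_normality_sub_le_of_pos ht hδ
  obtain ⟨ε, hε, h⟩ := exists_measureReal_devMax_devMin_le (fun _ : Fin 1 => true) one_pos
    one_pos hδ
  refine ⟨ε, hε, ?_⟩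
  filter_upwards [h, eventually_ge_atTop 2] with N hN hN2
  refine (measureReal_mono (fun e he => ?_) (measure_ne_top _ _)).trans (hN 0 0).1
  have hN' : (0 : ℝ) < N := by exact_mod_cast (by omega : 0 < N)
  simp only [Set.mem_ofPred_eq, sub_zero] at he ⊢
  rw [abs_of_nonneg (div_nonneg (normality_nonneg N e) (Real.sqrt_nonneg _)),
    div_le_iff₀ (Real.sqrt_pos.2 hN')] at he
  refine le_trans ?_ he
  simp only [devMax, Nat.div_one, zero_add, Finset.range_one, Finset.sup'_singleton, add_zero]
  exact abs_devSum_le_normality _ le_rfl (by simpa using hN2) le_rfl e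

end Anticoncentration

section Distribution

variable {Ω : Type*} {mΩ : MeasurableSpace Ω} {μ : Measure Ω} [IsProbabilityMeasure μ]

lemma abs_measureReal_le_sub_le (Y : Ω → ℝ) {s t ε : ℝ} (h : |s - t| ≤ ε) :
    |μ.real {ω | Y ω ≤ s} - μ.real {ω | Y ω ≤ t}| ≤ μ.real {ω | |Y ω - t| ≤ ε} := by
  have hε : 0 ≤ ε := (abs_nonneg _).trans h
  obtain ⟨h1, h2⟩ := abs_le.1 h
  rw [abs_sub_le_iff, sub_le_iff_le_add', sub_le_iff_le_add']
  constructor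
  · refine (measureReal_mono (fun ω hω => ?_) (measure_ne_top _ _)).trans (measureReal_union_le _ _)
    rcases le_or_gt (Y ω) t with h3 | h3
    · exact Or.inl h3
    · have h4 : Y ω ≤ s := hω
      exact Or.inr (show |Y ω - t| ≤ ε from abs_le.2 ⟨by linarith, by linarith⟩)
  · refine (measureReal_mono (fun ω hω => ?_) (measure_ne_top _ _)).trans (measureReal_union_le _ _)
    rcases le_or_gt (Y ω) s with h3 | h3
    · exact Or.inl h3
    · have h4 : Y ω ≤ t := hω
      exact Or.inr (show |Y ω - t| ≤ ε from abs_le.2 ⟨by linarith, by linarith⟩)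

/-- A Lipschitz function approximating the indicator of `Set.Iic t`. -/
lemma exists_lipschitz_approx_Iic (t : ℝ) {ε : ℝ} (hε : 0 < ε) :
    ∃ (A : NNReal) (f : ℝ → ℝ), LipschitzWith A f ∧ (∀ x, |f x| ≤ 1) ∧
      ∀ {Y : Ω → ℝ}, Measurable Y →
        |∫ ω, f (Y ω) ∂μ - μ.real {ω | Y ω ≤ t}| ≤ μ.real {ω | |Y ω - t| ≤ ε} := by
  obtain ⟨A, f, hlip, hf0, hf1, hle, hgt⟩ : ∃ (A : NNReal) (f : ℝ → ℝ), LipschitzWith A f ∧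
      (∀ x, 0 ≤ f x) ∧ (∀ x, f x ≤ 1) ∧ (∀ x ≤ t, f x = 1) ∧ ∀ x > t + ε, f x = 0 := by
    refine ⟨Real.toNNReal (1 / ε), fun x => max 0 (min 1 ((t + ε - x) / ε)),
      LipschitzWith.const_max (LipschitzWith.const_min (LipschitzWith.of_dist_le_mul
        fun x y => ?_) _) _, fun x => le_max_left _ _,
    fun x => max_le zero_le_one (min_le_left _ _),
      fun x hx => ?_, fun x hx => ?_⟩
    · rw [Real.coe_toNNReal _ (by positivity), Real.dist_eq, Real.dist_eq, ← sub_div, abs_div,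
        abs_of_pos hε, abs_sub_comm x y, one_div_mul_eq_div]
      exact le_of_eq (by congr 2; ring)
    · dsimp only
      rw [min_eq_left, max_eq_right zero_le_one]
      rw [le_div_iff₀ hε]
      linarith
    · dsimp only
      rw [max_eq_left]
      exact (min_le_right _ _).trans (div_nonpos_of_nonpos_of_nonneg (by linarith) hε.le)
  refine ⟨A, f, hlip, fun x => abs_le.2 ⟨by linarith [hf0 x], hf1 x⟩, fun {Y} hY => ?_⟩
  have hfm := hlip.continuous.measurable
  have hS : MeasurableSet {ω | Y ω ≤ t} := measurableSet_le hY measurable_const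
  have hT : MeasurableSet {ω | |Y ω - t| ≤ ε} :=
    measurableSet_le (hY.sub_const t).abs measurable_const
  have hfi : Integrable (fun ω => f (Y ω)) μ :=
    Integrable.of_bound (hfm.comp hY).aestronglyMeasurable 1 (ae_of_all _ fun ω => by
      rw [Real.norm_eq_abs, abs_of_nonneg (hf0 _)]
      exact hf1 _)
  have hSi : Integrable ({ω | Y ω ≤ t}.indicator (1 : Ω → ℝ)) μ :=
    (integrable_const (1 : ℝ)).indicator hS
  have hTi : Integrable ({ω | |Y ω - t| ≤ ε}.indicator (1 : Ω → ℝ)) μ :=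
    (integrable_const (1 : ℝ)).indicator hT
  rw [← integral_indicator_one hS, ← integral_indicator_one hT, ← integral_sub hfi hSi]
  refine abs_integral_le_integral_abs.trans (integral_mono (hfi.sub hSi).abs hTi fun ω => ?_)
  rcases le_or_gt (Y ω) t with h1 | h1
  · simp only [Set.indicator_of_mem (show ω ∈ {ω | Y ω ≤ t} from h1), Pi.one_apply, hle _ h1,
      sub_self, abs_zero]
    exact Set.indicator_nonneg (fun _ _ => zero_le_one) _
  · simp only [Set.indicator_of_notMem (show ω ∉ {ω | Y ω ≤ t} from not_le.2 h1), sub_zero,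
      abs_of_nonneg (hf0 _)]
    rcases le_or_gt (Y ω) (t + ε) with h2 | h2
    · rw [Set.indicator_of_mem (show ω ∈ {ω | |Y ω - t| ≤ ε} from
        (abs_le.2 ⟨by linarith, by linarith⟩ : |Y ω - t| ≤ ε))]
      exact hf1 _
    · rw [hgt _ h2]
      exact Set.indicator_nonneg (fun _ _ => zero_le_one) _

/-- Distribution functions of random variables which converge in law, are tight, and do not
concentrate converge to a continuous distribution function. -/
lemma exists_continuous_tendsto_measureReal_le {Z : ℕ → Ω → ℝ} (hZ : ∀ n, Measurable (Z n))
    (hlim : ∀ (A : NNReal) (f : ℝ → ℝ), LipschitzWith A f → (∀ x, |f x| ≤ 1) →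
      ∃ ℓ, Tendsto (fun n => ∫ ω, f (Z n ω) ∂μ) atTop (𝓝 ℓ))
    (hconc : ∀ t, ∀ δ > 0, ∃ ε > 0, ∀ᶠ n in atTop, μ.real {ω | |Z n ω - t| ≤ ε} ≤ δ)
    (htight : ∀ δ > 0, ∃ R, ∀ᶠ n in atTop, μ.real {ω | R < |Z n ω|} ≤ δ) :
    ∃ F : ℝ → ℝ, Continuous F ∧ Monotone F ∧ Tendsto F atBot (𝓝 0) ∧ Tendsto F atTop (𝓝 1) ∧
      ∀ t, Tendsto (fun n => μ.real {ω | Z n ω ≤ t}) atTop (𝓝 (F t)) := by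
  have hconv : ∀ t, ∃ ℓ, Tendsto (fun n => μ.real {ω | Z n ω ≤ t}) atTop (𝓝 ℓ) := by
    intro t
    refine cauchySeq_tendsto_of_complete (Metric.cauchySeq_iff'.2 fun δ hδ => ?_)
    obtain ⟨ε, hε, h⟩ := hconc t (δ / 8) (by positivity)
    obtain ⟨A, f, hf, hf1, happ⟩ := exists_lipschitz_approx_Iic (μ := μ) t hε
    obtain ⟨ℓ, hℓ⟩ := hlim A f hf hf1
    obtain ⟨N₀, hN₀⟩ := eventually_atTop.1
      (h.and (Metric.tendsto_nhds.1 hℓ (δ / 8) (by positivity)))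
    refine ⟨N₀, fun n hn => ?_⟩
    have h1 := hN₀ n hn
    have h2 := hN₀ N₀ le_rfl
    rw [Real.dist_eq] at h1 h2 ⊢
    have h3 := abs_le.1 ((happ (hZ n)).trans h1.1)
    have h4 := abs_le.1 ((happ (hZ N₀)).trans h2.1)
    have h5 := abs_lt.1 h1.2
    have h6 := abs_lt.1 h2.2
    rw [abs_lt]
    constructor <;> linarith [h3.1, h3.2, h4.1, h4.2, h5.1, h5.2, h6.1, h6.2]
  choose F hF using hconv
  have hmono : Monotone F := fun s t hst => le_of_tendsto_of_tendsto' (hF s) (hF t) fun n =>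
    measureReal_mono (fun ω hω => le_trans hω hst) (measure_ne_top _ _)
  have hF0 : ∀ t, 0 ≤ F t := fun t => ge_of_tendsto' (hF t) fun n => measureReal_nonneg
  have hF1 : ∀ t, F t ≤ 1 := fun t => le_of_tendsto' (hF t) fun n => measureReal_le_one
  refine ⟨F, ?_, hmono, ?_, ?_, hF⟩
  · refine Metric.continuous_iff.2 fun t δ hδ => ?_
    obtain ⟨ε, hε, h⟩ := hconc t (δ / 2) (by positivity)
    refine ⟨ε, hε, fun s hs => lt_of_le_of_lt ?_ (half_lt_self hδ)⟩
    rw [Real.dist_eq] at hs ⊢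
    exact le_of_tendsto ((hF s).sub (hF t)).abs
      (h.mono fun n hn => (abs_measureReal_le_sub_le _ hs.le).trans hn)
  · refine Metric.tendsto_nhds.2 fun δ hδ => ?_
    obtain ⟨R, hR⟩ := htight (δ / 2) (by positivity)
    filter_upwards [eventually_lt_atBot (-R)] with t ht
    rw [Real.dist_eq, sub_zero, abs_of_nonneg (hF0 t)]
    refine lt_of_le_of_lt (le_of_tendsto (hF t) (hR.mono fun n hn => ?_)) (half_lt_self hδ)
    refine (measureReal_mono (fun ω hω => ?_) (measure_ne_top _ _)).trans hn
    have hω' : Z n ω ≤ t := hω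
    exact show R < |Z n ω| from lt_abs.2 (Or.inr (by linarith))
  · refine Metric.tendsto_nhds.2 fun δ hδ => ?_
    obtain ⟨R, hR⟩ := htight (δ / 2) (by positivity)
    filter_upwards [eventually_ge_atTop R] with t ht
    rw [Real.dist_eq, abs_sub_comm, abs_of_nonneg (sub_nonneg.2 (hF1 t)), sub_lt_comm]
    refine lt_of_lt_of_le ?_ (ge_of_tendsto (b := 1 - δ / 2) (hF t) (hR.mono fun n hn => ?_))
    · linarith
    · rw [sub_le_iff_le_add', ← probReal_univ (μ := μ)]
      refine (measureReal_mono (fun ω _ => ?_) (measure_ne_top _ _)).trans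
        ((measureReal_union_le {ω | R < |Z n ω|} {ω | Z n ω ≤ t}).trans (add_le_add_left hn _))
      rcases le_or_gt (Z n ω) t with h | h
      · exact Or.inr h
      · exact Or.inl (lt_abs.2 (Or.inl (ht.trans_lt h)))

end Distribution

section Main

/-- The normalised normality measures are tight. -/
lemma exists_measureReal_normality_gt_le {δ : ℝ} (hδ : 0 < δ) : ∃ R : ℝ, ∀ᶠ N : ℕ in atTop,
    coinSeq.real {e | R < |normality N e / √N|} ≤ δ := by
  obtain ⟨K, -, hK⟩ := exists_measureReal_long_pattern_le one_pos (η := δ / 2) (by positivity)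
  obtain ⟨R, -, hR0, hR⟩ := exists_nat_ge_div_le (Fintype.card (ShortPattern K) * (7 * K ^ 5))
    (half_pos hδ) 1
  have hR1 : (1 : ℝ) ≤ R := by exact_mod_cast hR0
  refine ⟨R, ?_⟩
  filter_upwards [eventually_ge_atTop 1] with N hN
  have hN' : (0 : ℝ) < N := by exact_mod_cast hN
  have hsN : 0 < √(N : ℝ) := Real.sqrt_pos.2 hN'
  have hsub : {e | (R : ℝ) < |normality N e / √N|} ⊆
      {e | ∃ k > K, 2 ^ k ≤ N ∧ ∃ M ≤ N, ∃ X : Fin k → Bool, 1 * √N ≤ |devSum X M e|} ∪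
      {e | ∃ X : ShortPattern K, ∃ M ≤ N, R * √N ≤ |devSum X.2 M e|} := by
    intro e he
    simp only [Set.mem_ofPred_eq] at he
    rw [abs_of_nonneg (div_nonneg (normality_nonneg N e) hsN.le), lt_div_iff₀ hsN] at he
    obtain ⟨k, M, X, hk, hkN, -, hM, h⟩ := exists_lt_abs_devSum (by positivity) he
    rcases lt_or_ge K k with hkK | hkK
    · refine Or.inl ⟨k, hkK, hkN, M, by omega, X, le_trans ?_ h.le⟩
      gcongr
    · obtain ⟨k, rfl⟩ : ∃ k', k = k' + 1 := ⟨k - 1, by omega⟩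
      exact Or.inr ⟨⟨⟨k, by omega⟩, X⟩, M, by omega, h.le⟩
  refine (measureReal_mono hsub (measure_ne_top _ _)).trans ((measureReal_union_le _ _).trans ?_)
  rw [← add_halves δ]
  refine add_le_add (hK N) ((measureReal_exists_short_pattern_le K N N (by positivity) hN).trans
    (le_trans ?_ hR))
  rw [div_self hN'.ne', one_pow, mul_one, ← mul_div_assoc]
  gcongr
  exact le_self_pow₀ hR1 (by norm_num)

lemma unifMeasure_eq_map (N : ℕ) : unifMeasure N = coinSeq.map fun e (i : Fin N) => e i := by
  rw [map_coinSeq_of_injective Fin.val_injective]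
  refine Measure.ext_of_singleton fun w => ?_
  rw [Measure.infinitePi_singleton_of_fintype, unifMeasure,
    PMF.toMeasure_apply_singleton _ _ (measurableSet_singleton w)]
  simp [coin_singleton, ENNReal.inv_pow]

lemma unifMeasure_normality_le (N : ℕ) (t : ℝ) :
    (unifMeasure N {E | normality N (extendSeq E) / √N ≤ t}).toReal =
      coinSeq.real {e | normality N e / √N ≤ t} := by
  rw [unifMeasure_eq_map, Measure.map_apply (by fun_prop) .of_discrete, measureReal_def]
  simp only [Set.preimage_ofPred_eq, (dependsOn_normality N).extendSeq_restrict]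

end Main

/-- There is a continuous probability distribution function `F` such that, for
uniformly random `E_N ∈ {-1,1}^N`, `P(𝒩(E_N)/√N ≤ t) → F(t)` for every `t`. -/
theorem stmt18 :
    ∃ F : ℝ → ℝ, Continuous F ∧ Monotone F ∧
      Tendsto F atBot (𝓝 0) ∧ Tendsto F atTop (𝓝 1) ∧
      ∀ t : ℝ,
        Tendsto (fun N : ℕ =>
            (unifMeasure N {E | normality N (extendSeq E) / Real.sqrt N ≤ t}).toReal)
          atTop (𝓝 (F t)) := by
  simp only [unifMeasure_normality_le]
  refine exists_continuous_tendsto_measureReal_le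
    (fun N => (measurable_normality N).div_const _)
    (fun A f hf hf1 => exists_tendsto_integral_normality hf hf1) (fun t δ hδ => ?_)
    fun δ hδ => exists_measureReal_normality_gt_le hδ
  rcases le_or_gt 0 t with ht | ht
  · exact exists_measureReal_abs_normality_sub_le ht hδ
  · refine ⟨-t / 2, by linarith, Eventually.of_forall fun N => ?_⟩
    have : {e | |normality N e / √N - t| ≤ -t / 2} = ∅ := by
      ext e
      have := div_nonneg (normality_nonneg N e) (Real.sqrt_nonneg (N : ℝ))
      simp only [Set.mem_ofPred_eq, Set.mem_empty_iff_false, iff_false, not_le]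
      exact lt_abs.2 (Or.inl (by linarith))
    rw [this, measureReal_empty]
    exact hδ.le
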